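/- arXiv:2210.06561 — 7 statements merged into one kernel-verified Lean document; each statement's English description precedes it below -/
import Mathlib

section
/- Let d ≥ 7 be an integer, let q ∈ ℂ be a primitive d-th root of unity, and set ℓ = 2d/gcd(12, d+6). Then the kernel of the specialized reduced Burau representation β(−q) : B₃ → GL₂(ℂ) equals ncl_{B₃}({σ₁^d}) · ⟨τ₃^ℓ⟩, where τ₃ = (σ₁σ₂)³ is the full twist. -/
open Matrix

/-- The braid relations on `m` generators `σ₀, …, σ_{m-1}` (for the braid group `B_{m+1}`). -/
def braidRels (m : ℕ) : Set (FreeGroup (Fin m)) :=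
  {r | (∃ i j : Fin m, (i : ℕ) + 1 = (j : ℕ) ∧
        r = .of i * .of j * .of i * (.of j * .of i * .of j)⁻¹) ∨
       (∃ i j : Fin m, (i : ℕ) + 2 ≤ (j : ℕ) ∧
        r = .of i * .of j * (.of j * .of i)⁻¹)}

/-- The braid group `B_n`, presented on generators `σ₁, …, σ_{n-1}` (indexed by `Fin (n-1)`)
with the braid relations. -/
def BraidGroup (n : ℕ) : Type := PresentedGroup (braidRels (n - 1))

instance (n : ℕ) : Group (BraidGroup n) :=
  inferInstanceAs (Group (PresentedGroup (braidRels (n - 1))))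

/-- The generator `σ_{i+1}` of the braid group `B_n` (0-indexed: `braidGen n i = σ_{i+1}`). -/
def braidGen (n : ℕ) (i : Fin (n - 1)) : BraidGroup n := PresentedGroup.of i

/-- The full twist `τ_n = (σ₁ ⋯ σ_{n-1})ⁿ` in `B_n`. -/
def fullTwist (n : ℕ) : BraidGroup n :=
  ((List.ofFn fun i : Fin (n - 1) => braidGen n i).prod) ^ n

/-- The full twist `τ_{n-1} = (σ₁ ⋯ σ_{n-2})^{n-1}` on the first `n-1` strands, in `B_n`. -/
def subTwist (n : ℕ) : BraidGroup n :=
  ((List.ofFn fun i : Fin (n - 2) => braidGen n (Fin.castLE (by omega) i)).prod) ^ (n - 1)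

/-- The reduced Burau matrix of the generator `σ_{k+1}` of `B_n`, over a commutative ring `R`
with parameter `t`.  Row `k` has entries `t, -t, 1` in columns `k-1, k, k+1` (when present);
all other rows are the corresponding rows of the identity matrix. -/
def burauMatrix (n : ℕ) (R : Type*) [CommRing R] (t : R) (k : Fin (n - 1)) :
    Matrix (Fin (n - 1)) (Fin (n - 1)) R :=
  Matrix.of fun r c =>
    if r = k then
      if (c : ℕ) + 1 = (k : ℕ) then t
      else if c = k then -t
      else if (c : ℕ) = (k : ℕ) + 1 then 1
      else 0
    else if r = c then 1 else 0

section CoxeterFaithful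

variable {B W V : Type*} [Group W] {M : CoxeterMatrix B} (cs : CoxeterSystem M W)
  [AddCommGroup V] [Module ℝ V]

/-- Membership in the convex cone spanned by a finite family of vectors. -/
def InCone [Fintype B] (α : B → V) (v : V) : Prop :=
  ∃ c : B → ℝ, (∀ i, 0 ≤ c i) ∧ v = ∑ i, c i • α i

theorem InCone.combination [Fintype B] {α : B → V} {v w : V} (hv : InCone α v) (hw : InCone α w)
    {a b : ℝ} (ha : 0 ≤ a) (hb : 0 ≤ b) : InCone α (a • v + b • w) := by
  obtain ⟨c, hc, rfl⟩ := hv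
  obtain ⟨e, he, rfl⟩ := hw
  refine ⟨fun i => a * c i + b * e i, fun i => ?_, ?_⟩
  · have := hc i
    have := he i
    positivity
  · simp only [Finset.smul_sum, ← Finset.sum_add_distrib, add_smul, mul_smul]

theorem inCone_self [Fintype B] (α : B → V) (s : B) : InCone α (α s) := by
  classical
  refine ⟨Pi.single s 1, fun i => ?_, ?_⟩
  · by_cases h : i = s
    · subst h; simp
    · simp [h]
  · simp [Pi.single_apply, ite_smul]

/-- A real representation acts on the family `α` as the geometric representation of the Coxeter
group acts on its simple roots. -/
structure IsGeometric (ρ : W →* Module.End ℝ V) (α : B → V) : Prop where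
  simple_self : ∀ i, ρ (cs.simple i) (α i) = -α i
  simple_ne : ∀ i j, i ≠ j →
    ρ (cs.simple i) (α j) = α j + (2 * Real.cos (Real.pi / M i j)) • α i

variable {cs} {ρ : W →* Module.End ℝ V} {α : B → V}

theorem IsGeometric.alternatingWord_apply (h : IsGeometric cs ρ α) {s t : B} (hst : s ≠ t)
    (hsin : Real.sin (Real.pi / M s t) ≠ 0) (k : ℕ) :
    ρ (cs.wordProd (CoxeterSystem.alternatingWord s t k)) (α s) =
      (Real.sin ((k + 1 : ℕ) * (Real.pi / M s t)) / Real.sin (Real.pi / M s t)) •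
        α (if Even k then s else t) +
      (Real.sin (k * (Real.pi / M s t)) / Real.sin (Real.pi / M s t)) •
        α (if Even k then t else s) := by
  have hcos : M t s = M s t := M.symmetric t s
  generalize hθ : Real.pi / (M s t : ℝ) = θ at *
  have key (k : ℕ) : 2 * Real.cos θ * (Real.sin ((k + 1 : ℕ) * θ) / Real.sin θ)
      = Real.sin ((k + 1 + 1 : ℕ) * θ) / Real.sin θ + Real.sin (k * θ) / Real.sin θ := by
    have h1 : ((k + 1 + 1 : ℕ) : ℝ) * θ = (k + 1 : ℕ) * θ + θ := by push_cast; ring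
    have h2 : (k : ℝ) * θ = (k + 1 : ℕ) * θ - θ := by push_cast; ring
    rw [h1, h2, Real.sin_add, Real.sin_sub]
    ring
  induction k with
  | zero => simp [CoxeterSystem.alternatingWord, hsin]
  | succ k ih =>
    rw [CoxeterSystem.alternatingWord_succ', CoxeterSystem.wordProd_cons, map_mul,
      Module.End.mul_apply, ih]
    have hk := key k
    rcases Nat.even_or_odd k with he | ho
    · have hs : ¬ Even (k + 1) := by simpa [Nat.even_add_one] using he
      simp only [he, hs, if_true, if_false, map_add, map_smul, h.simple_self,
        h.simple_ne t s hst.symm, hcos, hθ]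
      rw [smul_add, smul_smul, mul_comm _ (2 * _), hk]
      module
    · have hn : ¬ Even k := by simpa using ho
      have hs : Even (k + 1) := by simpa [Nat.even_add_one] using ho
      simp only [hn, hs, if_true, if_false, map_add, map_smul, h.simple_self,
        h.simple_ne s t hst, hθ]
      rw [smul_add, smul_smul, mul_comm _ (2 * _), hk]
      module

theorem exists_maximal_alternating_suffix {w : W} {s t : B} (ht : cs.IsRightDescent w t) :
    ∃ k v, 0 < k ∧ w = v * cs.wordProd (CoxeterSystem.alternatingWord s t k) ∧
      cs.length w = cs.length v + k ∧
      ¬ cs.IsRightDescent v s ∧ ¬ cs.IsRightDescent v t := by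
  classical
  let P : ℕ → Prop := fun k => ∃ v, w = v * cs.wordProd (CoxeterSystem.alternatingWord s t k) ∧
      cs.length w = cs.length v + k
  have h1 : P 1 := by
    refine ⟨w * cs.simple t, ?_, ?_⟩
    · simp [CoxeterSystem.alternatingWord]
    · exact (cs.isRightDescent_iff.1 ht).symm
  have hl : 1 ≤ cs.length w := by obtain ⟨v, -, h⟩ := h1; omega
  have hP := Nat.findGreatest_spec (P := P) hl h1
  have hpos : 1 ≤ Nat.findGreatest P (cs.length w) := Nat.le_findGreatest hl h1
  have hmax (j : ℕ) (hj : P j) : j ≤ Nat.findGreatest P (cs.length w) :=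
    Nat.le_findGreatest (by obtain ⟨v, -, h⟩ := hj; omega) hj
  generalize Nat.findGreatest P (cs.length w) = k at hP hpos hmax
  obtain ⟨v, hv, hlen⟩ := hP
  have hnext : ¬ cs.IsRightDescent v (if Even k then t else s) := by
    intro hd
    have : k + 1 ≤ k := hmax (k + 1) ⟨v * cs.simple (if Even k then t else s), by
      rw [CoxeterSystem.alternatingWord_succ', CoxeterSystem.wordProd_cons, hv]
      simp [mul_assoc], by
      have := cs.isRightDescent_iff.1 hd
      omega⟩
    omega
  have hprev : ¬ cs.IsRightDescent v (if Even k then s else t) := by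
    intro hd
    obtain ⟨j, rfl⟩ : ∃ j, k = j + 1 := ⟨k - 1, by omega⟩
    have hj : (if Even (j + 1) then s else t) = if Even j then t else s := by
      by_cases he : Even j <;> simp [Nat.even_add_one, he]
    rw [hj] at hd
    rw [CoxeterSystem.alternatingWord_succ', CoxeterSystem.wordProd_cons, ← mul_assoc] at hv
    have hle := cs.length_mul_le (v * cs.simple (if Even j then t else s))
      (cs.wordProd (CoxeterSystem.alternatingWord s t j))
    rw [← hv] at hle
    have hle2 := cs.length_wordProd_le (CoxeterSystem.alternatingWord s t j)
    rw [CoxeterSystem.length_alternatingWord] at hle2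
    have := cs.isRightDescent_iff.1 hd
    omega
  refine ⟨k, v, hpos, hv, hlen, ?_⟩
  by_cases he : Even k
  · simp only [he, if_true] at hnext hprev
    exact ⟨hprev, hnext⟩
  · simp only [he, if_false] at hnext hprev
    exact ⟨hnext, hprev⟩

theorem lt_of_not_isRightDescent_mul_alternatingWord {v w : W} {s t : B} {k : ℕ}
    (hM : M s t ≠ 0) (hw : w = v * cs.wordProd (CoxeterSystem.alternatingWord s t k))
    (hlen : cs.length w = cs.length v + k) (hs : ¬ cs.IsRightDescent w s) : k < M s t := by
  by_contra! hk
  have hM' : M t s = M s t := M.symmetric t s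
  have hred := cs.not_isReduced_alternatingWord t s (m := k + 1) (by omega) (by omega)
  have hle := cs.length_wordProd_le (CoxeterSystem.alternatingWord t s (k + 1))
  rw [CoxeterSystem.IsReduced] at hred
  rw [CoxeterSystem.length_alternatingWord] at hred hle
  have hlt := lt_of_le_of_ne hle hred
  have hws : w * cs.simple s = v * cs.wordProd (CoxeterSystem.alternatingWord t s (k + 1)) := by
    rw [CoxeterSystem.alternatingWord_succ, CoxeterSystem.wordProd_concat, hw, mul_assoc]
  have h1 := cs.length_mul_le v (cs.wordProd (CoxeterSystem.alternatingWord t s (k + 1)))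
  rw [← hws] at h1
  have h2 := cs.not_isRightDescent_iff.1 hs
  omega

/-- If right multiplication by `s` lengthens `w`, then `w` sends the simple root of `s` to a
nonnegative combination of simple roots. -/
theorem IsGeometric.inCone [Fintype B] (h : IsGeometric cs ρ α) (hM : ∀ i j, M i j ≠ 0) (n : ℕ) :
    ∀ w, cs.length w = n → ∀ s, ¬ cs.IsRightDescent w s → InCone α (ρ w (α s)) := by
  induction n using Nat.strong_induction_on with
  | _ n ih =>
  intro w hn s hs
  by_cases hw : w = 1
  · subst hw
    simpa using inCone_self α s
  obtain ⟨t, ht⟩ := cs.exists_rightDescent_of_ne_one hw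
  have hst : s ≠ t := by rintro rfl; exact hs ht
  obtain ⟨k, v, hk, hwv, hlen, hvs, hvt⟩ := exists_maximal_alternating_suffix (s := s) ht
  have hkM := lt_of_not_isRightDescent_mul_alternatingWord (hM s t) hwv hlen hs
  have hMpos : (0 : ℝ) < M s t := by exact_mod_cast Nat.pos_of_ne_zero (hM s t)
  have hsin (j : ℕ) (hj : j ≤ M s t) : 0 ≤ Real.sin (j * (Real.pi / M s t)) := by
    apply Real.sin_nonneg_of_nonneg_of_le_pi
    · have := Real.pi_pos; positivity
    · have : (j : ℝ) ≤ M s t := by exact_mod_cast hj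
      rw [← mul_div_assoc, div_le_iff₀ hMpos, mul_comm]
      exact mul_le_mul_of_nonneg_left this Real.pi_pos.le
  have hM1 : 1 < M s t := by omega
  have hsin0 : 0 < Real.sin (Real.pi / M s t) := by
    apply Real.sin_pos_of_pos_of_lt_pi
    · have := Real.pi_pos; positivity
    · exact div_lt_self Real.pi_pos (by exact_mod_cast hM1)
  have hcone (x : B) (hx : x = s ∨ x = t) : InCone α (ρ v (α x)) := by
    apply ih (cs.length v) (by omega) v rfl
    rcases hx with rfl | rfl <;> assumption
  rw [hwv, map_mul, Module.End.mul_apply, h.alternatingWord_apply hst hsin0.ne', map_add,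
    map_smul, map_smul]
  apply InCone.combination
  · apply hcone; split_ifs <;> simp
  · apply hcone; split_ifs <;> simp
  · exact div_nonneg (hsin _ (by omega)) hsin0.le
  · exact div_nonneg (hsin _ (by omega)) hsin0.le

/-- Faithfulness of the geometric representation of a Coxeter group whose Coxeter matrix has only
finite entries. -/
theorem IsGeometric.eq_one [Fintype B] (h : IsGeometric cs ρ α) (hM : ∀ i j, M i j ≠ 0)
    (hα : LinearIndependent ℝ α) {w : W} (hw : ρ w = 1) : w = 1 := by
  classical
  by_contra hne
  obtain ⟨s, hs⟩ := cs.exists_rightDescent_of_ne_one hne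
  have hns := cs.isRightDescent_iff_not_isRightDescent_mul.1 hs
  obtain ⟨c, hc, hsum⟩ := h.inCone hM _ _ rfl s hns
  rw [map_mul, hw, one_mul, h.simple_self] at hsum
  have hzero : ∑ i, (c i + if i = s then 1 else 0) • α i = 0 := by
    simp [add_smul, Finset.sum_add_distrib, ← hsum, ite_smul]
  have := Fintype.linearIndependent_iff.1 hα _ hzero s
  have := hc s
  simp at *
  linarith

end CoxeterFaithful

section TriangleGroup

theorem braidThree_relation :
    braidGen 3 0 * braidGen 3 1 * braidGen 3 0 = braidGen 3 1 * braidGen 3 0 * braidGen 3 1 :=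
  PresentedGroup.mk_eq_mk_of_mul_inv_mem (rels := braidRels (3 - 1))
    (Or.inl ⟨0, 1, rfl, rfl⟩)

/-- The homomorphism out of `B₃` determined by two elements satisfying the braid relation. -/
def braidThreeLift {H : Type*} [Group H] (x y : H) (h : x * y * x = y * x * y) :
    BraidGroup 3 →* H :=
  PresentedGroup.toGroup (rels := braidRels (3 - 1)) (f := ![x, y]) (by
    rintro r (⟨i, j, hij, rfl⟩ | ⟨i, j, hij, rfl⟩)
    · have hi : i = 0 := Fin.ext (by have := j.2; simp; omega)
      have hj : j = 1 := Fin.ext (by have := j.2; simp; omega)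
      subst hi hj
      simp only [map_mul, map_inv, FreeGroup.lift_apply_of, mul_inv_eq_one]
      exact h
    · have := j.2
      omega)

section Lift

variable {H : Type*} [Group H] (x y : H) (h : x * y * x = y * x * y)

@[simp] theorem braidThreeLift_zero : braidThreeLift x y h (braidGen 3 0) = x :=
  PresentedGroup.toGroup.of _

@[simp] theorem braidThreeLift_one : braidThreeLift x y h (braidGen 3 1) = y :=
  PresentedGroup.toGroup.of _

end Lift

theorem braidThree_hom_ext {H : Type*} [Monoid H] {φ ψ : BraidGroup 3 →* H}
    (h0 : φ (braidGen 3 0) = ψ (braidGen 3 0)) (h1 : φ (braidGen 3 1) = ψ (braidGen 3 1)) :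
    φ = ψ := by
  have h : φ.toHomUnits = ψ.toHomUnits := by
    refine PresentedGroup.ext (rels := braidRels (3 - 1)) fun i => Units.ext ?_
    fin_cases i
    · exact h0
    · exact h1
  ext x
  exact congrArg Units.val (DFunLike.congr_fun h x)

theorem fullTwist_three : fullTwist 3 = (braidGen 3 0 * braidGen 3 1) ^ 3 := by
  simp [fullTwist, List.ofFn_succ]

theorem sq_eq_fullTwist_three :
    (braidGen 3 0 * (braidGen 3 0 * braidGen 3 1)) ^ 2 = fullTwist 3 := by
  have h := braidThree_relation
  rw [fullTwist_three]
  generalize braidGen 3 0 = a at *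
  generalize braidGen 3 1 = b at *
  calc (a * (a * b)) ^ 2 = a * (a * b * a) * (a * b) := by simp only [pow_two, mul_assoc]
    _ = (a * b) ^ 3 := by rw [h]; simp only [pow_succ, pow_zero, one_mul, mul_assoc]

theorem fullTwist_three_mem_center : fullTwist 3 ∈ Subgroup.center (BraidGroup 3) := by
  have key : MulAut.conj (fullTwist 3) = 1 := by
    have hg : Commute (fullTwist 3) (braidGen 3 0 * braidGen 3 1) := by
      rw [fullTwist_three]
      exact Commute.pow_self _ _
    have hag : Commute (fullTwist 3) (braidGen 3 0 * (braidGen 3 0 * braidGen 3 1)) := by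
      rw [← sq_eq_fullTwist_three]
      exact Commute.pow_self _ _
    have ha : Commute (fullTwist 3) (braidGen 3 0) := by
      simpa only [mul_inv_cancel_right] using hag.mul_right hg.inv_right
    have hb : Commute (fullTwist 3) (braidGen 3 1) := by
      simpa using ha.inv_right.mul_right hg
    have : (MulAut.conj (fullTwist 3)).toMonoidHom = MonoidHom.id _ :=
      braidThree_hom_ext (by simp [ha.eq]) (by simp [hb.eq])
    ext x
    exact DFunLike.congr_fun this x
  rw [Subgroup.mem_center_iff]
  intro g
  have := DFunLike.congr_fun key g
  simp only [MulAut.conj_apply, MulAut.one_apply, mul_inv_eq_iff_eq_mul] at this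
  exact this.symm

/-- The Coxeter matrix of the triangle group `(2, 3, d)`. -/
def triangleMatrix (d : ℕ) (hd : d ≠ 1) : CoxeterMatrix (Fin 3) where
  M := !![1, d, 2; d, 1, 3; 2, 3, 1]
  isSymm := by ext i j; fin_cases i <;> fin_cases j <;> rfl
  diagonal i := by fin_cases i <;> rfl
  off_diagonal i j h := by fin_cases i <;> fin_cases j <;> simp_all

theorem mul_pow_eq_one_swap {N : Type*} [Monoid N] {x y : N} (hy : y * y = 1) {m : ℕ}
    (h : (x * y) ^ m = 1) : (y * x) ^ m = 1 := by
  have hs : SemiconjBy y ((x * y) ^ m) ((y * x) ^ m) :=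
    SemiconjBy.pow_right (by simp [SemiconjBy, mul_assoc]) m
  have := hs.eq
  rw [h, mul_one] at this
  calc (y * x) ^ m = (y * x) ^ m * y * y := by rw [mul_assoc, hy, mul_one]
    _ = 1 := by rw [← this, hy]

theorem triangleMatrix_isLiftable {N : Type*} [Monoid N] {d : ℕ} (hd : d ≠ 1) {r : Fin 3 → N}
    (hr : ∀ i, r i * r i = 1) (h01 : (r 0 * r 1) ^ d = 1) (h12 : (r 1 * r 2) ^ 3 = 1)
    (h02 : (r 0 * r 2) ^ 2 = 1) : (triangleMatrix d hd).IsLiftable r := by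
  intro i j
  fin_cases i <;> fin_cases j
  · simpa [triangleMatrix] using hr 0
  · exact h01
  · exact h02
  · exact mul_pow_eq_one_swap (hr 1) h01
  · simpa [triangleMatrix] using hr 1
  · exact h12
  · exact mul_pow_eq_one_swap (hr 2) h02
  · exact mul_pow_eq_one_swap (hr 2) h12
  · simpa [triangleMatrix] using hr 2

/-- The map from `B₃` onto the rotations of the triangle group `(2, 3, d)`. -/
def braidThreeToTriangle (d : ℕ) (hd : d ≠ 1) : BraidGroup 3 →* (triangleMatrix d hd).Group :=
  let s := (triangleMatrix d hd).simple
  braidThreeLift (s 0 * s 1) (s 1 * s 0 * (s 1 * s 2)) (by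
    have h0 : s 0 * s 0 = 1 := (triangleMatrix d hd).toCoxeterSystem.simple_mul_simple_self 0
    have h1 : s 1 * s 1 = 1 := (triangleMatrix d hd).toCoxeterSystem.simple_mul_simple_self 1
    have h2 : s 2 * s 2 = 1 := (triangleMatrix d hd).toCoxeterSystem.simple_mul_simple_self 2
    have h12 : (s 1 * s 2) ^ 3 = 1 :=
      (triangleMatrix d hd).toCoxeterSystem.simple_mul_simple_pow 1 2
    have h02 : (s 0 * s 2) ^ 2 = 1 :=
      (triangleMatrix d hd).toCoxeterSystem.simple_mul_simple_pow 0 2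
    have hinv : (s 0 * s 1)⁻¹ = s 1 * s 0 := by
      rw [_root_.mul_inv_rev, inv_eq_of_mul_eq_one_left h0, inv_eq_of_mul_eq_one_left h1]
    have hsq : s 1 * s 2 * (s 0 * s 1) * (s 1 * s 2 * (s 0 * s 1)) = 1 := by
      have h20 := mul_pow_eq_one_swap h2 h02
      calc _ = s 1 * (s 2 * s 0 * (s 1 * s 1) * (s 2 * s 0)) * s 1 := by simp only [mul_assoc]
        _ = 1 := by rw [h1, mul_one, ← pow_two, h20, mul_one, h1]
    rw [← hinv]
    generalize s 0 * s 1 = a at *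
    generalize s 1 * s 2 = g at *
    have e1 : a * (a⁻¹ * g) * a = g * a := by group
    have e2 : a⁻¹ * g * a * (a⁻¹ * g) = a⁻¹ * g⁻¹ := by
      rw [inv_eq_of_mul_eq_one_left (show g * g * g = 1 by rw [← h12, pow_succ, pow_two])]
      group
    rw [e1, e2, ← _root_.mul_inv_rev]
    exact (inv_eq_of_mul_eq_one_left hsq).symm)

/-- The normal subgroup of `B₃` generated by `σ₁ ^ d` and the full twist. -/
abbrev triangleKernel (d : ℕ) : Subgroup (BraidGroup 3) :=
  Subgroup.normalClosure {braidGen 3 0 ^ d} ⊔ Subgroup.zpowers (fullTwist 3)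

instance : (Subgroup.zpowers (fullTwist 3)).Normal :=
  ⟨fun n hn g => by
    have hc := Subgroup.zpowers_le.2 fullTwist_three_mem_center hn
    rwa [Subgroup.mem_center_iff.1 hc g, mul_inv_cancel_right]⟩

/-- An involutive endomorphism `ε` inverting both `a` and `g` yields a representation of the
triangle group by permutations in which the rotations act by left multiplication. -/
theorem triangle_action_isLiftable {G : Type*} [Group G] {d : ℕ} (hd : d ≠ 1) {a g : G}
    (ε : Equiv.Perm G) (hmul : ∀ x y, ε (x * y) = ε x * ε y) (hε : ε * ε = 1)
    (ha : ε a = a⁻¹) (hg : ε g = g⁻¹) (had : a ^ d = 1) (hg3 : g ^ 3 = 1)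
    (hag : (a * g) ^ 2 = 1) :
    (triangleMatrix d hd).IsLiftable
      ![MulAction.toPermHom G G a * ε, ε, ε * MulAction.toPermHom G G g] := by
  have hcomm (x : G) : ε * MulAction.toPermHom G G x = MulAction.toPermHom G G (ε x) * ε := by
    ext y
    simp [hmul]
  have hsq (x : G) (hx : ε x = x⁻¹) :
      MulAction.toPermHom G G x * ε * (MulAction.toPermHom G G x * ε) = 1 := by
    rw [mul_assoc, ← mul_assoc ε, hcomm, mul_assoc _ ε, hε, hx, mul_one, ← map_mul,
      mul_inv_cancel, map_one]
  apply triangleMatrix_isLiftable hd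
  · intro i
    fin_cases i
    · exact hsq a ha
    · exact hε
    · have := hsq g⁻¹ (by rw [← hg, ← Equiv.Perm.mul_apply, hε, Equiv.Perm.one_apply, hg, inv_inv])
      rw [← hg, ← hcomm] at this
      exact this
  · simp only [cons_val_zero, cons_val_one]
    rw [mul_assoc, hε, mul_one, ← map_pow, had, map_one]
  · change (ε * (ε * _)) ^ 3 = 1
    rw [← mul_assoc, hε, one_mul, ← map_pow, hg3, map_one]
  · change (MulAction.toPermHom G G a * ε * (ε * MulAction.toPermHom G G g)) ^ 2 = 1
    rw [mul_assoc, ← mul_assoc ε, hε, one_mul, ← map_mul, ← map_pow, hag, map_one]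

theorem ker_braidThreeToTriangle_le (d : ℕ) (hd : d ≠ 1) :
    (braidThreeToTriangle d hd).ker ≤ triangleKernel d := by
  let π := QuotientGroup.mk' (triangleKernel d)
  set a := π (braidGen 3 0) with ha
  set g := π (braidGen 3 0 * braidGen 3 1) with hg
  have hb : π (braidGen 3 1) = a⁻¹ * g := by rw [ha, hg, map_mul, inv_mul_cancel_left]
  have had : a ^ d = 1 := by
    rw [ha, ← map_pow]
    exact (QuotientGroup.eq_one_iff _).2
      (Subgroup.mem_sup_left (Subgroup.subset_normalClosure rfl))
  have hτ : π (fullTwist 3) = 1 :=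
    (QuotientGroup.eq_one_iff _).2 (Subgroup.mem_sup_right (Subgroup.mem_zpowers _))
  have hg3 : g ^ 3 = 1 := by rw [hg, ← map_pow, ← fullTwist_three, hτ]
  have hag : (a * g) ^ 2 = 1 := by rw [ha, hg, ← map_mul, ← map_pow, sq_eq_fullTwist_three, hτ]
  let φ : BraidGroup 3 →* BraidGroup 3 ⧸ triangleKernel d := braidThreeLift a⁻¹ (a * g⁻¹) (by
    have e1 : a⁻¹ * (a * g⁻¹) * a⁻¹ = (a * g)⁻¹ := by group
    have e2 : a * g⁻¹ * a⁻¹ * (a * g⁻¹) = a * g := by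
      calc _ = a * g * (g ^ 3)⁻¹ := by group
        _ = a * g := by rw [hg3, inv_one, mul_one]
    rw [e1, e2]
    exact inv_eq_of_mul_eq_one_left (by rw [← pow_two, hag]))
  have hφa : φ (braidGen 3 0) = a⁻¹ := by simp [φ]
  have hφg : φ (braidGen 3 0 * braidGen 3 1) = g⁻¹ := by simp [φ]
  have hφτ : φ (fullTwist 3) = 1 :=
    (congrArg φ fullTwist_three).trans (by rw [map_pow, hφg, inv_pow, hg3, inv_one])
  let ε : BraidGroup 3 ⧸ triangleKernel d →* BraidGroup 3 ⧸ triangleKernel d :=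
    QuotientGroup.lift _ φ (by
      refine sup_le (Subgroup.normalClosure_le_normal ?_) ?_
      · rw [Set.singleton_subset_iff]
        change φ _ = 1
        simp [φ, had]
      · rw [Subgroup.zpowers_le]
        exact hφτ)
  have hεa : ε a = a⁻¹ := hφa
  have hεg : ε g = g⁻¹ := hφg
  have hinv (x) : ε (ε x) = x := by
    obtain ⟨x, rfl⟩ := QuotientGroup.mk'_surjective _ x
    have : (ε.comp ε).comp π = π := by
      apply braidThree_hom_ext
      · simp [← ha, hεa]
      · simp [hb, hεa, hεg]
    exact DFunLike.congr_fun this x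
  let e : Equiv.Perm (BraidGroup 3 ⧸ triangleKernel d) := ⟨ε, ε, hinv, hinv⟩
  have hl := triangle_action_isLiftable hd e (map_mul ε) (Equiv.ext hinv) hεa hεg had hg3 hag
  let ψ := (triangleMatrix d hd).toCoxeterSystem.lift ⟨_, hl⟩
  have hs (i) : ψ ((triangleMatrix d hd).simple i) = _ :=
    (triangleMatrix d hd).toCoxeterSystem.lift_apply_simple hl i
  have hee : e * e = 1 := Equiv.ext hinv
  have h01 : ψ ((triangleMatrix d hd).simple 0) * ψ ((triangleMatrix d hd).simple 1) =
      MulAction.toPermHom _ _ a := by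
    rw [hs, hs]
    change MulAction.toPermHom _ _ a * e * e = _
    rw [mul_assoc, hee, mul_one]
  have h12 : ψ ((triangleMatrix d hd).simple 1) * ψ ((triangleMatrix d hd).simple 2) =
      MulAction.toPermHom _ _ g := by
    rw [hs, hs]
    change e * (e * MulAction.toPermHom _ _ g) = _
    rw [← mul_assoc, hee, one_mul]
  have h10 : ψ ((triangleMatrix d hd).simple 1) * ψ ((triangleMatrix d hd).simple 0) =
      MulAction.toPermHom _ _ a⁻¹ := by
    rw [map_inv, ← h01, _root_.mul_inv_rev, ← map_inv, ← map_inv]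
    congr 2 <;> exact ((triangleMatrix d hd).toCoxeterSystem.inv_simple _).symm
  have hcomp : ψ.comp (braidThreeToTriangle d hd) = (MulAction.toPermHom _ _).comp π := by
    apply braidThree_hom_ext
    · simp only [MonoidHom.comp_apply, braidThreeToTriangle, braidThreeLift_zero, map_mul]
      exact h01
    · simp only [MonoidHom.comp_apply, braidThreeToTriangle, braidThreeLift_one, map_mul ψ]
      rw [h10, h12, ← map_mul, hb]
  intro w hw
  have h := DFunLike.congr_fun hcomp w
  rw [MonoidHom.comp_apply, MonoidHom.mem_ker.1 hw, map_one] at h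
  have h1 := Equiv.congr_fun h 1
  have hπ : π w = 1 := by simpa using h1.symm
  exact (QuotientGroup.eq_one_iff w).1 hπ

end TriangleGroup

section Reflections

variable {A : Type*} [Ring A] [Algebra ℝ A]

/-- The map `X ↦ -a X a`; for an involution `a` this is minus the conjugation by `a`. -/
def negConj (a : A) : Module.End ℝ A := -(LinearMap.mulLeft ℝ a * LinearMap.mulRight ℝ a)

theorem negConj_apply (a x : A) : negConj a x = -(a * x * a) := by
  simp [negConj, mul_assoc]

theorem negConj_mul_negConj_apply (a b x : A) :
    (negConj a * negConj b) x = a * b * x * (b * a) := by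
  simp [negConj_apply, mul_assoc]

theorem negConj_mul_self {a : A} (ha : a * a = 1) : negConj a * negConj a = 1 := by
  ext x
  rw [negConj_mul_negConj_apply, ha, one_mul, mul_one, Module.End.one_apply]

theorem negConj_mul_pow {a b : A} (hb : b * b = 1) {m : ℕ}
    (h : (a * b) ^ m = 1 ∨ (a * b) ^ m = -1) : (negConj a * negConj b) ^ m = 1 := by
  have hpow (k : ℕ) (x : A) :
      ((negConj a * negConj b) ^ k) x = (a * b) ^ k * x * (b * a) ^ k := by
    induction k generalizing x with
    | zero => simp
    | succ k ih =>
      rw [pow_succ, Module.End.mul_apply, ih, negConj_mul_negConj_apply, pow_succ (a * b),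
        pow_succ' (b * a)]
      simp only [mul_assoc]
  have hswap : b * (a * b) ^ m * b = (b * a) ^ m := by
    have hs : SemiconjBy b ((a * b) ^ m) ((b * a) ^ m) :=
      SemiconjBy.pow_right (by simp [SemiconjBy, mul_assoc]) m
    rw [hs.eq, mul_assoc, hb, mul_one]
  ext x
  rw [hpow, ← hswap]
  rcases h with h | h <;> simp [h, hb]

/-- Conjugation by units, as a representation. -/
def unitsConj : Aˣ →* Module.End ℝ A where
  toFun u := LinearMap.mulLeft ℝ (u : A) * LinearMap.mulRight ℝ (↑u⁻¹ : A)
  map_one' := by ext; simp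
  map_mul' u v := by ext; simp [mul_assoc]

theorem negConj_mul_negConj_eq_unitsConj {a b : A} (ha : a * a = 1) (hb : b * b = 1) {z w : A}
    (hzw : z * w = 1) (hz : ∀ x, z * x = x * z) (u : Aˣ) (h : a * b = z * u) :
    negConj a * negConj b = unitsConj u := by
  have hinv : b * a = w * (↑u⁻¹ : A) := by
    have h1 : a * b * (b * a) = 1 := by rw [mul_assoc, ← mul_assoc b, hb, one_mul, ha]
    have h2 : w * (↑u⁻¹ : A) * (a * b) = 1 := by
      rw [h, hz, ← mul_assoc, mul_assoc w, Units.inv_mul, mul_one, ← hz, hzw]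
    exact (left_inv_eq_right_inv h2 h1).symm
  ext x
  rw [negConj_mul_negConj_apply, hinv, h]
  calc z * u * x * (w * ↑u⁻¹) = z * (u * x * w) * ↑u⁻¹ := by simp only [mul_assoc]
    _ = u * x * (z * w) * ↑u⁻¹ := by rw [hz, mul_assoc _ w, ← hz w]
    _ = unitsConj u x := by simp [hzw, unitsConj, mul_assoc]

theorem negConj_apply_of_anticommutator {a b : A} (ha : a * a = 1) {c : ℝ}
    (h : a * b + b * a = (-c) • (1 : A)) : negConj a b = b + c • a := by
  have hba : b * a = (-c) • (1 : A) - a * b := eq_sub_of_add_eq' h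
  rw [negConj_apply, mul_assoc, hba, mul_sub, ← mul_assoc, ha, one_mul, mul_smul_comm, mul_one,
    neg_smul]
  abel

end Reflections

section Burau

/-- Three involutions of `ℂ²` whose pairwise products are, up to scalars, the Burau matrices of
`σ₁`, `σ₁σ₂` and `σ₁²σ₂` at `t = -p²`, where `D² = 1 - p² + p⁴`. -/
noncomputable def burauRoot (p D : ℂ) : Fin 3 → Matrix (Fin 2) (Fin 2) ℂ :=
  ![(-(p * D)⁻¹) • !![1, -p ^ 4 - 1; 1 - p ^ 2, -1],
    D⁻¹ • !![1, -p ^ 2; 1 - p ^ 2, -1],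
    (-D⁻¹) • !![p ^ 2, 1 - p ^ 2; 1, -p ^ 2]]

theorem burauRoot_mul_self {p D : ℂ} (hp : p ≠ 0) (hD : D ≠ 0)
    (h : D ^ 2 = 1 - p ^ 2 + p ^ 4) (i : Fin 3) : burauRoot p D i * burauRoot p D i = 1 := by
  fin_cases i <;> ext i j <;> fin_cases i <;> fin_cases j <;>
    simp [burauRoot, Matrix.mul_apply, Fin.sum_univ_two] <;> field_simp <;> grind

theorem burauRoot_zero_mul_one {p D : ℂ} (hp : p ≠ 0) (hD : D ≠ 0)
    (h : D ^ 2 = 1 - p ^ 2 + p ^ 4) :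
    burauRoot p D 0 * burauRoot p D 1 = (-p⁻¹) • !![p ^ 2, 1; 0, 1] := by
  ext i j
  fin_cases i <;> fin_cases j <;>
    simp [burauRoot, Matrix.mul_apply, Fin.sum_univ_two] <;> field_simp <;> grind

theorem burauRoot_one_mul_two {p D : ℂ} (hp : p ≠ 0) (hD : D ≠ 0)
    (h : D ^ 2 = 1 - p ^ 2 + p ^ 4) :
    burauRoot p D 1 * burauRoot p D 2 = !![0, -1; 1, -1] := by
  ext i j
  fin_cases i <;> fin_cases j <;>
    simp [burauRoot, Matrix.mul_apply, Fin.sum_univ_two] <;> field_simp <;> grind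

theorem burauRoot_zero_mul_two_sq {p D : ℂ} (hp : p ≠ 0) (hD : D ≠ 0)
    (h : D ^ 2 = 1 - p ^ 2 + p ^ 4) :
    (burauRoot p D 0 * burauRoot p D 2) ^ 2 = -1 := by
  have : burauRoot p D 0 * burauRoot p D 2 = p⁻¹ • !![-1, p ^ 2 + 1; -1, 1] := by
    ext i j
    fin_cases i <;> fin_cases j <;>
      simp [burauRoot, Matrix.mul_apply, Fin.sum_univ_two] <;> field_simp <;> grind
  rw [this]
  ext i j
  fin_cases i <;> fin_cases j <;>
    simp [pow_two, Matrix.mul_apply, Fin.sum_univ_two] <;> field_simp <;> grind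

theorem burauRoot_linearIndependent {p D : ℂ} (hp : p ≠ 0) (hD : D ≠ 0)
    (h : D ^ 2 = 1 - p ^ 2 + p ^ 4) : LinearIndependent ℝ (burauRoot p D) := by
  rw [Fintype.linearIndependent_iff]
  intro c hc
  have h00 := congrFun (congrFun hc 0) 0
  have h01 := congrFun (congrFun hc 0) 1
  have h10 := congrFun (congrFun hc 1) 0
  simp only [Fin.sum_univ_three, burauRoot, Matrix.add_apply, Matrix.smul_apply,
    Complex.real_smul] at h00 h01 h10
  simp at h00 h01 h10
  field_simp at h00 h01 h10
  have hD2 : 1 - p ^ 2 + p ^ 4 ≠ 0 := h ▸ pow_ne_zero 2 hD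
  have e2 : (c 2 : ℂ) = 0 := by
    have : p * (1 - p ^ 2 + p ^ 4) * (c 2 : ℂ) = 0 := by grind
    simpa [hp, hD2] using this
  have e0 : (c 0 : ℂ) = 0 := by
    have : (1 - p ^ 2 + p ^ 4) * (c 0 : ℂ) = 0 := by grind
    simpa [hD2] using this
  have e1 : (c 1 : ℂ) = 0 := by
    have : p * (c 1 : ℂ) = 0 := by grind
    simpa [hp] using this
  intro i
  fin_cases i
  · exact_mod_cast e0
  · exact_mod_cast e1
  · exact_mod_cast e2

theorem burauRoot_anticommutator_zero_one {p D : ℂ} (hp : p ≠ 0) (hD : D ≠ 0)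
    (h : D ^ 2 = 1 - p ^ 2 + p ^ 4) :
    burauRoot p D 0 * burauRoot p D 1 + burauRoot p D 1 * burauRoot p D 0 =
      (-(p + p⁻¹)) • (1 : Matrix (Fin 2) (Fin 2) ℂ) := by
  ext i j
  fin_cases i <;> fin_cases j <;>
    simp [burauRoot] <;> field_simp <;> grind

theorem burauRoot_anticommutator_one_two {p D : ℂ} (hp : p ≠ 0) (hD : D ≠ 0)
    (h : D ^ 2 = 1 - p ^ 2 + p ^ 4) :
    burauRoot p D 1 * burauRoot p D 2 + burauRoot p D 2 * burauRoot p D 1 = -1 := by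
  ext i j
  fin_cases i <;> fin_cases j <;>
    simp [burauRoot] <;> field_simp <;> grind

theorem burauRoot_anticommutator_zero_two {p D : ℂ} (hp : p ≠ 0) (hD : D ≠ 0) :
    burauRoot p D 0 * burauRoot p D 2 + burauRoot p D 2 * burauRoot p D 0 = 0 := by
  ext i j
  fin_cases i <;> fin_cases j <;>
    simp [burauRoot] <;> field_simp <;> grind

theorem isGeometric_of_anticommutator {B W A : Type*} [Group W] {M : CoxeterMatrix B}
    (cs : CoxeterSystem M W) [Ring A] [Algebra ℝ A] {α : B → A} {ρ : W →* Module.End ℝ A}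
    (hρ : ∀ i, ρ (cs.simple i) = negConj (α i)) (hsq : ∀ i, α i * α i = 1)
    (hanti : ∀ i j, i ≠ j →
      α i * α j + α j * α i = (-(2 * Real.cos (Real.pi / M i j))) • (1 : A)) :
    IsGeometric cs ρ α where
  simple_self i := by rw [hρ, negConj_apply, hsq, one_mul]
  simple_ne i j hij := by rw [hρ, negConj_apply_of_anticommutator (hsq i) (hanti i j hij)]

theorem upperTriangular_pow_eq_one {K : Type*} [Field K] {q : K} {d : ℕ} (hq : q ^ d = 1)
    (hq1 : q ≠ 1) : (!![q, 1; 0, 1] : Matrix (Fin 2) (Fin 2) K) ^ d = 1 := by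
  have h (k : ℕ) : (!![q, 1; 0, 1] : Matrix (Fin 2) (Fin 2) K) ^ k =
      !![q ^ k, (q ^ k - 1) / (q - 1); 0, 1] := by
    have := sub_ne_zero.2 hq1
    induction k with
    | zero => simp [Matrix.one_fin_two]
    | succ k ih =>
      rw [pow_succ, ih]
      ext i j
      fin_cases i <;> fin_cases j <;> simp [Matrix.mul_apply, pow_succ]
      field_simp
      ring
  rw [h, hq]
  simp [Matrix.one_fin_two]

theorem isPrimitiveRoot_exp_pi_mul_I_div {d : ℕ} (hd : d ≠ 0) :
    IsPrimitiveRoot (Complex.exp (Real.pi * Complex.I / d)) (2 * d) := by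
  convert Complex.isPrimitiveRoot_exp (2 * d) (by omega) using 2
  push_cast
  field_simp

theorem ker_le_triangleKernel {d : ℕ} (hd : 7 ≤ d) {p : ℂ}
    (hp : p = Complex.exp (Real.pi * Complex.I / d))
    (f : BraidGroup 3 →* GL (Fin 2) ℂ)
    (h0 : (f (braidGen 3 0) : Matrix (Fin 2) (Fin 2) ℂ) = !![p ^ 2, 1; 0, 1])
    (h1 : (f (braidGen 3 1) : Matrix (Fin 2) (Fin 2) ℂ) = !![1, 0; -p ^ 2, p ^ 2]) :
    f.ker ≤ triangleKernel d := by
  have hd0 : (d : ℂ) ≠ 0 := by exact_mod_cast (by omega : d ≠ 0)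
  have hd1 : d ≠ 1 := by omega
  have hp0 : p ≠ 0 := hp ▸ Complex.exp_ne_zero _
  have hpd : p ^ d = -1 := by
    rw [hp, ← Complex.exp_nat_mul, mul_div_cancel₀ _ hd0, Complex.exp_pi_mul_I]
  have hprim : IsPrimitiveRoot p (2 * d) := hp ▸ isPrimitiveRoot_exp_pi_mul_I_div (by omega)
  have hcos : p + p⁻¹ = (2 * Real.cos (Real.pi / d) : ℝ) := by
    rw [hp, ← Complex.exp_neg]
    push_cast
    rw [Complex.two_cos]
    congr 2 <;> ring
  have hq1 : p ^ 2 ≠ 1 := fun h => by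
    have := Nat.le_of_dvd (by norm_num) (hprim.dvd_of_pow_eq_one 2 h)
    omega
  have hD0 : 1 - p ^ 2 + p ^ 4 ≠ 0 := fun h => by
    have h12 : p ^ 12 = 1 := by linear_combination (p ^ 8 + p ^ 6 - p ^ 2 - 1) * h
    have := Nat.le_of_dvd (by norm_num) (hprim.dvd_of_pow_eq_one 12 h12)
    omega
  obtain ⟨D, hD⟩ := IsAlgClosed.exists_pow_nat_eq (1 - p ^ 2 + p ^ 4) (n := 2) (by norm_num)
  have hDne : D ≠ 0 := by rintro rfl; exact hD0 (by rw [← hD]; norm_num)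
  have hsq := burauRoot_mul_self hp0 hDne hD
  have h01 := burauRoot_zero_mul_one hp0 hDne hD
  have h12 := burauRoot_one_mul_two hp0 hDne hD
  set α := burauRoot p D with hα
  let cs := (triangleMatrix d hd1).toCoxeterSystem
  have hl : (triangleMatrix d hd1).IsLiftable fun i => negConj (α i) := by
    apply triangleMatrix_isLiftable hd1
    · exact fun i => negConj_mul_self (hsq i)
    · apply negConj_mul_pow (hsq 1)
      rw [h01, smul_pow, upperTriangular_pow_eq_one (by rw [← pow_mul]; exact hprim.pow_eq_one) hq1,
        neg_pow, inv_pow, hpd]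
      rcases neg_one_pow_eq_or ℂ d with h | h <;> simp [h, inv_neg]
    · apply negConj_mul_pow (hsq 2)
      left
      rw [h12]
      ext i j
      fin_cases i <;> fin_cases j <;> simp [pow_succ, Matrix.mul_apply]
    · exact negConj_mul_pow (hsq 2) (Or.inr (burauRoot_zero_mul_two_sq hp0 hDne hD))
  let ρ := cs.lift ⟨_, hl⟩
  have hρ (i) : ρ (cs.simple i) = negConj (α i) := cs.lift_apply_simple hl i
  have hgeo : IsGeometric cs ρ α := by
    have a01 := burauRoot_anticommutator_zero_one hp0 hDne hD
    have a12 := burauRoot_anticommutator_one_two hp0 hDne hD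
    have a02 := burauRoot_anticommutator_zero_two hp0 hDne
    rw [hcos, ← hα] at a01
    rw [← hα] at a12 a02
    have e01 : α 0 * α 1 + α 1 * α 0 = (-(2 * Real.cos (Real.pi / d))) •
        (1 : Matrix (Fin 2) (Fin 2) ℂ) := by
      rw [a01, ← Complex.ofReal_neg, ← Complex.coe_smul]
    have e12 : α 1 * α 2 + α 2 * α 1 = (-(2 * Real.cos (Real.pi / (3 : ℕ)))) •
        (1 : Matrix (Fin 2) (Fin 2) ℂ) := by
      rw [a12]; simp
    have e02 : α 0 * α 2 + α 2 * α 0 = (-(2 * Real.cos (Real.pi / (2 : ℕ)))) •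
        (1 : Matrix (Fin 2) (Fin 2) ℂ) := by
      rw [a02]; simp
    apply isGeometric_of_anticommutator cs hρ hsq
    intro i j hij
    fin_cases i <;> fin_cases j
    · exact absurd rfl hij
    · exact e01
    · exact e02
    · exact (add_comm _ _).trans e01
    · exact absurd rfl hij
    · exact e12
    · exact (add_comm _ _).trans e02
    · exact (add_comm _ _).trans e12
    · exact absurd rfl hij
  have hM (i j : Fin 3) : triangleMatrix d hd1 i j ≠ 0 := by
    fin_cases i <;> fin_cases j <;> simp [triangleMatrix] <;> omega
  have c01 : negConj (α 0) * negConj (α 1) = unitsConj (f (braidGen 3 0)) := by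
    refine negConj_mul_negConj_eq_unitsConj (hsq 0) (hsq 1)
      (z := Matrix.scalar _ (-p⁻¹)) (w := Matrix.scalar _ (-p)) ?_ ?_ _ ?_
    · rw [← map_mul]; simp [hp0]
    · exact Matrix.scalar_comm _ fun _ => Commute.all _ _
    · rw [h01, h0, Matrix.scalar_apply, ← Matrix.smul_eq_diagonal_mul]
  have c12 : negConj (α 1) * negConj (α 2) =
      unitsConj (f (braidGen 3 0 * braidGen 3 1)) := by
    refine negConj_mul_negConj_eq_unitsConj (hsq 1) (hsq 2)
      (z := Matrix.scalar _ (-(p ^ 2)⁻¹)) (w := Matrix.scalar _ (-p ^ 2)) ?_ ?_ _ ?_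
    · rw [← map_mul]; simp [hp0]
    · exact Matrix.scalar_comm _ fun _ => Commute.all _ _
    · rw [h12, map_mul, Units.val_mul, h0, h1]
      ext i j
      fin_cases i <;> fin_cases j <;> simp [Matrix.mul_apply, Fin.sum_univ_two, hp0]
  have hcomp : ρ.comp (braidThreeToTriangle d hd1) = unitsConj.comp f := by
    apply braidThree_hom_ext
    · simp only [MonoidHom.comp_apply, braidThreeToTriangle, braidThreeLift_zero, map_mul]
      exact (congrArg₂ (· * ·) (hρ 0) (hρ 1)).trans c01
    · simp only [MonoidHom.comp_apply, braidThreeToTriangle, braidThreeLift_one, map_mul ρ]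
      calc _ = negConj (α 1) * negConj (α 0) * (negConj (α 1) * negConj (α 2)) :=
            congrArg₂ (· * ·) (congrArg₂ (· * ·) (hρ 1) (hρ 0)) (congrArg₂ (· * ·) (hρ 1) (hρ 2))
        _ = negConj (α 1) * (negConj (α 0) * negConj (α 0)) * negConj (α 1) *
            unitsConj (f (braidGen 3 1)) := by
          rw [c12, map_mul, map_mul, ← c01]
          simp only [mul_assoc]
        _ = _ := by rw [negConj_mul_self (hsq 0), mul_one, negConj_mul_self (hsq 1), one_mul]
  intro w hw
  apply ker_braidThreeToTriangle_le d hd1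
  apply hgeo.eq_one hM (burauRoot_linearIndependent hp0 hDne hD)
  have := DFunLike.congr_fun hcomp w
  rwa [MonoidHom.comp_apply, MonoidHom.comp_apply, MonoidHom.mem_ker.1 hw, map_one] at this

theorem ker_eq_of_exp {d : ℕ} (hd : 7 ≤ d) {p : ℂ}
    (hp : p = Complex.exp (Real.pi * Complex.I / d))
    (f : BraidGroup 3 →* GL (Fin 2) ℂ)
    (h0 : (f (braidGen 3 0) : Matrix (Fin 2) (Fin 2) ℂ) = !![p ^ 2, 1; 0, 1])
    (h1 : (f (braidGen 3 1) : Matrix (Fin 2) (Fin 2) ℂ) = !![1, 0; -p ^ 2, p ^ 2]) :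
    f.ker = Subgroup.normalClosure {braidGen 3 0 ^ d} ⊔
      Subgroup.zpowers (fullTwist 3 ^ (2 * d / Nat.gcd 12 (d + 6))) := by
  have hd0 : (d : ℂ) ≠ 0 := by exact_mod_cast (by omega : d ≠ 0)
  have hpd : p ^ d = -1 := by
    rw [hp, ← Complex.exp_nat_mul, mul_div_cancel₀ _ hd0, Complex.exp_pi_mul_I]
  have hprim : IsPrimitiveRoot p (2 * d) := hp ▸ isPrimitiveRoot_exp_pi_mul_I_div (by omega)
  have hq1 : p ^ 2 ≠ 1 := fun h => by
    have := Nat.le_of_dvd (by norm_num) (hprim.dvd_of_pow_eq_one 2 h)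
    omega
  have hncl : Subgroup.normalClosure {braidGen 3 0 ^ d} ≤ f.ker := by
    apply Subgroup.normalClosure_le_normal
    rw [Set.singleton_subset_iff]
    change f _ = 1
    apply Units.ext
    rw [map_pow, Units.val_pow_eq_pow_val, h0]
    exact upperTriangular_pow_eq_one (by rw [← pow_mul]; exact hprim.pow_eq_one) hq1
  have hτ : (f (fullTwist 3) : Matrix (Fin 2) (Fin 2) ℂ) = Matrix.scalar _ (p ^ (d + 6)) := by
    rw [fullTwist_three, map_pow, map_mul, Units.val_pow_eq_pow_val, Units.val_mul, h0, h1, pow_add,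
      hpd]
    ext i j
    fin_cases i <;> fin_cases j <;> simp [pow_succ, Matrix.mul_apply, Fin.sum_univ_two] <;> ring
  have hord : orderOf (f (fullTwist 3)) = 2 * d / Nat.gcd 12 (d + 6) := by
    have hscalar : orderOf (Matrix.scalar (Fin 2) (p ^ (d + 6))) = orderOf (p ^ (d + 6)) :=
      orderOf_injective (Matrix.scalar (Fin 2) (α := ℂ)).toMonoidHom
        (fun _ _ h => Matrix.scalar_inj.1 h) _
    rw [← orderOf_units, hτ, hscalar, orderOf_pow' _ (by omega), ← hprim.eq_orderOf]
    congr 1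
    have h2 : Nat.gcd (2 * d) (d + 6) ∣ 12 := by
      have := Nat.dvd_sub (dvd_mul_of_dvd_right (Nat.gcd_dvd_right (2 * d) (d + 6)) 2)
        (Nat.gcd_dvd_left (2 * d) (d + 6))
      rwa [show 2 * (d + 6) - 2 * d = 12 by omega] at this
    have h3 : Nat.gcd 12 (d + 6) ∣ 2 * d := by
      have := Nat.dvd_sub (dvd_mul_of_dvd_right (Nat.gcd_dvd_right 12 (d + 6)) 2)
        (Nat.gcd_dvd_left 12 (d + 6))
      rwa [show 2 * (d + 6) - 12 = 2 * d by omega] at this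
    exact Nat.dvd_antisymm (Nat.dvd_gcd h2 (Nat.gcd_dvd_right _ _))
      (Nat.dvd_gcd h3 (Nat.gcd_dvd_right _ _))
  apply le_antisymm
  · intro w hw
    obtain ⟨x, hx, y, ⟨k, rfl⟩, rfl⟩ :=
      Subgroup.mem_sup_of_normal_left.1 (ker_le_triangleKernel hd hp f h0 h1 hw)
    refine mul_mem (Subgroup.mem_sup_left hx) (Subgroup.mem_sup_right ?_)
    have hk : f (fullTwist 3) ^ k = 1 := by
      have := MonoidHom.mem_ker.1 hw
      rwa [map_mul, MonoidHom.mem_ker.1 (hncl hx), one_mul, map_zpow] at this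
    obtain ⟨m, rfl⟩ := orderOf_dvd_iff_zpow_eq_one.2 hk
    refine ⟨m, ?_⟩
    simp only [hord, _root_.zpow_mul, _root_.zpow_natCast]
  · refine sup_le hncl ?_
    rw [Subgroup.zpowers_le, MonoidHom.mem_ker, map_pow, ← hord, pow_orderOf_eq_one]

/-- The reduced Burau representation of `B₃` over a field, specialized at `t = -q`. -/
noncomputable def burauThree {K : Type*} [Field K] (q : K) (hq : q ≠ 0) :
    BraidGroup 3 →* GL (Fin 2) K :=
  braidThreeLift
    (Matrix.GeneralLinearGroup.mkOfDetNeZero !![q, 1; 0, 1] (by simpa using hq))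
    (Matrix.GeneralLinearGroup.mkOfDetNeZero !![1, 0; -q, q] (by simpa using hq)) (by
      apply Units.ext
      ext i j
      fin_cases i <;> fin_cases j <;>
        simp [Matrix.GeneralLinearGroup.mkOfDetNeZero, Matrix.mul_apply, Fin.sum_univ_two])

theorem burauThree_zero {K : Type*} [Field K] (q : K) (hq : q ≠ 0) :
    (burauThree q hq (braidGen 3 0) : Matrix (Fin 2) (Fin 2) K) = !![q, 1; 0, 1] := by
  rw [burauThree, braidThreeLift_zero]
  rfl

theorem burauThree_one {K : Type*} [Field K] (q : K) (hq : q ≠ 0) :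
    (burauThree q hq (braidGen 3 1) : Matrix (Fin 2) (Fin 2) K) = !![1, 0; -q, q] := by
  rw [burauThree, braidThreeLift_one]
  rfl

theorem ker_burauThree_map {K L : Type*} [Field K] [Field L] (e : K →+* L) (q : K) (hq : q ≠ 0)
    (f : BraidGroup 3 →* GL (Fin 2) L)
    (h0 : (f (braidGen 3 0) : Matrix (Fin 2) (Fin 2) L) = !![e q, 1; 0, 1])
    (h1 : (f (braidGen 3 1) : Matrix (Fin 2) (Fin 2) L) = !![1, 0; -e q, e q]) :
    f.ker = (burauThree q hq).ker := by
  have hf : f = (Matrix.GeneralLinearGroup.map e).comp (burauThree q hq) := by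
    apply braidThree_hom_ext
    · apply Units.ext
      change _ = (burauThree q hq (braidGen 3 0) : Matrix (Fin 2) (Fin 2) K).map e
      rw [h0, burauThree_zero]
      ext i j
      fin_cases i <;> fin_cases j <;> simp
    · apply Units.ext
      change _ = (burauThree q hq (braidGen 3 1) : Matrix (Fin 2) (Fin 2) K).map e
      rw [h1, burauThree_one]
      ext i j
      fin_cases i <;> fin_cases j <;> simp
  rw [hf]
  exact MonoidHom.ker_comp_of_injective _ _
    (Units.map_injective (Matrix.map_injective e.injective))

/-- The kernel does not depend on the choice of the primitive root of unity. -/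
theorem ker_eq_ker_of_isPrimitiveRoot {d : ℕ} (hd : d ≠ 0) {q r : ℂ} (hq : IsPrimitiveRoot q d)
    (hr : IsPrimitiveRoot r d) (f g : BraidGroup 3 →* GL (Fin 2) ℂ)
    (hf0 : (f (braidGen 3 0) : Matrix (Fin 2) (Fin 2) ℂ) = !![q, 1; 0, 1])
    (hf1 : (f (braidGen 3 1) : Matrix (Fin 2) (Fin 2) ℂ) = !![1, 0; -q, q])
    (hg0 : (g (braidGen 3 0) : Matrix (Fin 2) (Fin 2) ℂ) = !![r, 1; 0, 1])
    (hg1 : (g (braidGen 3 1) : Matrix (Fin 2) (Fin 2) ℂ) = !![1, 0; -r, r]) :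
    f.ker = g.ker := by
  have hpos := Nat.pos_of_ne_zero hd
  have : Fact (Irreducible (Polynomial.cyclotomic d ℚ)) :=
    ⟨Polynomial.cyclotomic.irreducible_rat hpos⟩
  have hroot {x : ℂ} (hx : IsPrimitiveRoot x d) :
      (Polynomial.cyclotomic d ℚ).eval₂ (algebraMap ℚ ℂ) x = 0 := by
    rw [Polynomial.eval₂_eq_eval_map, Polynomial.map_cyclotomic]
    exact hx.isRoot_cyclotomic hpos
  have hz : AdjoinRoot.root (Polynomial.cyclotomic d ℚ) ≠ 0 := fun h => hq.ne_zero hd <| by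
    rw [← AdjoinRoot.lift_root (hroot hq), h, map_zero]
  rw [ker_burauThree_map (AdjoinRoot.lift _ q (hroot hq)) _ hz f (by rwa [AdjoinRoot.lift_root])
      (by rwa [AdjoinRoot.lift_root]),
    ker_burauThree_map (AdjoinRoot.lift _ r (hroot hr)) _ hz g (by rwa [AdjoinRoot.lift_root])
      (by rwa [AdjoinRoot.lift_root])]

end Burau

/-- Burau₃ at roots of unity: for `q` a primitive `d`-th root of unity, `d ≥ 7`,
the kernel of the specialized reduced Burau representation `β(-q) : B₃ → GL₂(ℂ)` is
`ncl({σ₁^d}) · ⟨τ₃^ℓ⟩` with `ℓ = 2d / gcd(12, d+6)`. -/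
theorem burau3_kernel_at_roots_of_unity
    (d : ℕ) (hd : 7 ≤ d) (q : ℂ) (hq : IsPrimitiveRoot q d)
    (f : BraidGroup 3 →* GL (Fin (3 - 1)) ℂ)
    (hf : ∀ i, (f (braidGen 3 i) : Matrix (Fin (3 - 1)) (Fin (3 - 1)) ℂ) =
      burauMatrix 3 ℂ (-q) i) :
    f.ker = Subgroup.normalClosure {braidGen 3 0 ^ d} ⊔
      Subgroup.zpowers (fullTwist 3 ^ (2 * d / Nat.gcd 12 (d + 6))) := by
  have hf0 : (f (braidGen 3 0) : Matrix (Fin 2) (Fin 2) ℂ) = !![q, 1; 0, 1] := by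
    refine (hf 0).trans ?_
    ext i j
    fin_cases i <;> fin_cases j <;> simp [burauMatrix]
  have hf1 : (f (braidGen 3 1) : Matrix (Fin 2) (Fin 2) ℂ) = !![1, 0; -q, q] := by
    refine (hf 1).trans ?_
    ext i j
    fin_cases i <;> fin_cases j <;> simp [burauMatrix]
  set p := Complex.exp (Real.pi * Complex.I / d) with hp
  have hr : IsPrimitiveRoot (p ^ 2) d := by
    rw [hp, ← Complex.exp_nat_mul]
    convert Complex.isPrimitiveRoot_exp d (by omega) using 2
    push_cast
    ring
  have hp2 : p ^ 2 ≠ 0 := pow_ne_zero 2 (Complex.exp_ne_zero _)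
  rw [← ker_eq_of_exp hd hp (burauThree (p ^ 2) hp2) (burauThree_zero _ _) (burauThree_one _ _)]
  exact ker_eq_ker_of_isPrimitiveRoot (by omega) hq hr f _ hf0 hf1
    (burauThree_zero _ _) (burauThree_one _ _)
end

section
/- Let n ≥ 3, let d ≥ 2 and let q ∈ ℂ be a primitive d-th root of unity. Let j, ℓ be positive integers such that (−q)^{(n−1)j} = 1, (−q)^{n−1} ≠ 1, and (−q)^{nℓ} = 1. Then the subgroup ncl_{B_n}({σ₁^d, τ_{n−1}^j}) · ⟨τ_n^ℓ⟩ of B_n is contained in the kernel of the specialized reduced Burau representation β(−q) : B_n → GL_{n−1}(ℂ). -/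
open Matrix

section PowEqOne

variable {K A : Type*} [Field K] [Ring A] [Algebra K A]

/-- If `(a - s)(a - 1) = 0` with `s ≠ 1` and `s ^ k = 1`, then `a ^ k = 1`. -/
lemma pow_eq_one_of_mul_sub_one_eq_smul {a : A} {s : K}
    (h : a * (a - 1) = s • (a - 1)) (hs : s ≠ 1) {k : ℕ} (hk : s ^ k = 1) : a ^ k = 1 := by
  have key : ∀ i : ℕ, (s - 1) • (a ^ i - 1) = (s ^ i - 1) • (a - 1) := by
    intro i
    induction i with
    | zero => simp
    | succ i ih =>
      have e : a ^ (i + 1) - 1 = a * (a ^ i - 1) + (a - 1) := by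
        rw [pow_succ']; noncomm_ring
      rw [e, smul_add, ← mul_smul_comm, ih, mul_smul_comm, h, smul_smul, ← add_smul]
      congr 1
      ring
  have hk_eq := key k
  rw [hk, sub_self, zero_smul, smul_eq_zero] at hk_eq
  exact sub_eq_zero.mp (hk_eq.resolve_left (sub_ne_zero.mpr hs))

end PowEqOne

section Burau

variable {R : Type*} [CommRing R]

/-- The action of a reduced Burau matrix, on vectors written as sequences padded by zeros. -/
lemma burauMatrix_mulVec {n : ℕ} (t : R) (k : Fin (n - 1)) {V : ℕ → R}
    (h0 : V 0 = 0) (hn : V n = 0) :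
    burauMatrix n R t k *ᵥ (fun r => V (r + 1)) =
      fun r => if r = k then t * V k - t * V (k + 1) + V (k + 2) else V (r + 1) := by
  have hk := k.isLt
  funext r
  by_cases hr : r = k
  · subst hr
    let F : ℕ → R := fun c => (if c + 1 = r then t * V r else 0) +
      (if c = r then -t * V (r + 1) else 0) + (if c = r + 1 then V (r + 2) else 0)
    have e : ∀ c : Fin (n - 1), burauMatrix n R t r r c * V (c + 1) = F c := by
      intro c
      simp only [F, burauMatrix, Matrix.of_apply, if_true, Fin.ext_iff]
      split_ifs with h₁ h₂ h₃ <;> first | omega | simp_all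
    simp only [Matrix.mulVec, dotProduct, if_true]
    rw [Finset.sum_congr rfl fun c _ => e c, Fin.sum_univ_eq_sum_range F,
      Finset.sum_add_distrib, Finset.sum_add_distrib, Finset.sum_ite_eq', Finset.sum_ite_eq',
      if_pos (Finset.mem_range.mpr hk)]
    have e₁ : (∑ c ∈ Finset.range (n - 1), if c + 1 = (r : ℕ) then t * V r else 0) = t * V r := by
      rcases Nat.eq_zero_or_pos (r : ℕ) with h | h
      · simp [h, h0]
      · rw [Finset.sum_eq_single ((r : ℕ) - 1)]
        · rw [if_pos (by omega)]
        · intro b _ hb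
          rw [if_neg (by omega)]
        · intro hb
          exact absurd (Finset.mem_range.mpr (by omega)) hb
    have e₂ : (if (r : ℕ) + 1 ∈ Finset.range (n - 1) then V (r + 2) else 0) = V (r + 2) := by
      split_ifs with h
      · rfl
      · rw [Finset.mem_range] at h
        rw [show (r : ℕ) + 2 = n by omega, hn]
    rw [e₁, e₂]
    ring
  · simp [Matrix.mulVec, dotProduct, burauMatrix, hr]

/-- The action of the product of the first `p` reduced Burau matrices. -/
lemma prod_burauMatrix_mulVec {n : ℕ} (t : R) (p : ℕ) (hp : p ≤ n - 1) {V : ℕ → R}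
    (h0 : V 0 = 0) (hn : V n = 0) :
    (List.ofFn fun i : Fin p => burauMatrix n R t (Fin.castLE hp i)).prod *ᵥ
        (fun r => V (r + 1)) =
      fun r : Fin (n - 1) => if (r : ℕ) < p then t * V r - t * V p + V (p + 1) else V (r + 1) := by
  induction p generalizing V with
  | zero => simp
  | succ p ih =>
    rw [List.ofFn_succ', List.concat_eq_append, List.prod_append, List.prod_singleton,
      ← Matrix.mulVec_mulVec, burauMatrix_mulVec t _ h0 hn]
    let W : ℕ → R := fun i =>
      if i = p + 1 then t * V p - t * V (p + 1) + V (p + 2) else V i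
    have hW : (fun r : Fin (n - 1) => if r = Fin.castLE hp (Fin.last p) then
        t * V (Fin.castLE hp (Fin.last p)) - t * V (Fin.castLE hp (Fin.last p) + 1) +
          V (Fin.castLE hp (Fin.last p) + 2) else V (r + 1)) =
        fun r : Fin (n - 1) => W (r + 1) := by
      funext r
      simp [W, Fin.ext_iff]
    rw [hW]
    have := ih (by omega) (V := W) (by simp [W, h0])
      (by simp only [W]; rw [if_neg (by omega), hn])
    refine Eq.trans this ?_
    funext r
    simp only [W]
    split_ifs <;> first | omega | skip
    · ring
    · rw [show (r : ℕ) = p by omega]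
    · rfl

/-- The product of the first `p` reduced Burau matrices is `t` times a cyclic shift on vectors
supported on the first `p` coordinates. -/
lemma prod_burauMatrix_mulVec_cyclic {n : ℕ} (t : R) (p : ℕ) (hp : p ≤ n - 1) (hn : 0 < n)
    (u : ZMod (p + 1) → R) :
    (List.ofFn fun i : Fin p => burauMatrix n R t (Fin.castLE hp i)).prod *ᵥ
        (fun r => if (r : ℕ) < p then u ((r : ℕ) + 1) - u 0 else 0) =
      t • fun r : Fin (n - 1) =>
        if (r : ℕ) < p then u ((r : ℕ) + 1 - 1) - u (0 - 1) else 0 := by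
  have hp_cast : (p : ZMod (p + 1)) = 0 - 1 := by
    have := ZMod.natCast_self (p + 1)
    push_cast at this
    linear_combination this
  have := prod_burauMatrix_mulVec t p hp
    (V := fun i => if i ≤ p then u i - u 0 else 0) (by simp) (if_neg (by omega))
  simp only [Nat.succ_le_iff, Nat.cast_add, Nat.cast_one] at this
  rw [this]
  funext r
  by_cases h : (r : ℕ) < p
  · simp [h, h.le, hp_cast]
    ring
  · simp [h]

/-- The `(p + 1)`-st power of the product of the first `p` reduced Burau matrices acts as
`t ^ (p + 1)` on vectors supported on the first `p` coordinates. -/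
lemma prod_burauMatrix_pow_mulVec {n : ℕ} (t : R) (p : ℕ) (hp : p ≤ n - 1) (hn : 0 < n)
    {v : Fin (n - 1) → R} (hv : ∀ r : Fin (n - 1), p ≤ r → v r = 0) :
    (List.ofFn fun i : Fin p => burauMatrix n R t (Fin.castLE hp i)).prod ^ (p + 1) *ᵥ v =
      t ^ (p + 1) • v := by
  have key : ∀ (i : ℕ) (u : ZMod (p + 1) → R),
      (List.ofFn fun i : Fin p => burauMatrix n R t (Fin.castLE hp i)).prod ^ i *ᵥ
        (fun r => if (r : ℕ) < p then u ((r : ℕ) + 1) - u 0 else 0) =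
      t ^ i • fun r : Fin (n - 1) =>
        if (r : ℕ) < p then u ((r : ℕ) + 1 - i) - u (0 - i) else 0 := by
    intro i
    induction i with
    | zero => intro u; simp
    | succ i ih =>
      intro u
      rw [pow_succ, ← Matrix.mulVec_mulVec, prod_burauMatrix_mulVec_cyclic t p hp hn,
        Matrix.mulVec_smul, ih fun x => u (x - 1), smul_smul, pow_succ']
      simp only [Nat.cast_add, Nat.cast_one, sub_sub]
  let u : ZMod (p + 1) → R := fun x =>
    if h : x.val - 1 < n - 1 then if x.val = 0 then 0 else v ⟨x.val - 1, h⟩ else 0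
  have hu : (fun r : Fin (n - 1) => if (r : ℕ) < p then u ((r : ℕ) + 1) - u 0 else 0) = v := by
    funext r
    split_ifs with h
    · have hval : ((r : ℕ) + 1 : ZMod (p + 1)).val = r + 1 := by
        have := ZMod.val_natCast_of_lt (n := p + 1) (a := r + 1) (by omega)
        rwa [Nat.cast_add, Nat.cast_one] at this
      have hne : ((r : ℕ) + 1 : ZMod (p + 1)) ≠ 0 := fun h₀ => by simp [h₀] at hval
      simp [u, hval, hne]
    · exact (hv r (by omega)).symm
  have h := key (p + 1) u
  simp only [ZMod.natCast_self, sub_zero] at h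
  rwa [hu] at h

/-- The Burau matrix of the full twist is the scalar `t ^ n`. -/
lemma prod_burauMatrix_pow {n : ℕ} (t : R) (hn : 0 < n) :
    (List.ofFn fun i => burauMatrix n R t i).prod ^ n = t ^ n • 1 := by
  refine Matrix.ext_of_mulVec_single fun i => ?_
  have h := prod_burauMatrix_pow_mulVec t (n - 1) le_rfl hn (v := Pi.single i 1)
    (fun r hr => absurd r.isLt (by omega))
  rw [Nat.sub_add_cancel hn] at h
  rw [Matrix.smul_mulVec, Matrix.one_mulVec]
  exact h

/-- The Burau matrix `a` of the full twist on `n - 1` strands satisfies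
`(a - t ^ (n - 1)) (a - 1) = 0`. -/
lemma prod_burauMatrix_castLE_pow_mul_sub_one {n : ℕ} (t : R) (hn : 2 ≤ n)
    (h : n - 2 ≤ n - 1) :
    letI a := (List.ofFn fun i : Fin (n - 2) =>
      burauMatrix n R t (Fin.castLE h i)).prod ^ (n - 1)
    a * (a - 1) = t ^ (n - 1) • (a - 1) := by
  set D := (List.ofFn fun i : Fin (n - 2) => burauMatrix n R t (Fin.castLE h i)).prod with hD
  have hlast : ∀ (i : ℕ) (v : Fin (n - 1) → R) (r : Fin (n - 1)), n - 2 ≤ r →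
      (D ^ i *ᵥ v) r = v r := by
    intro i
    induction i with
    | zero => intro v r _; simp
    | succ i ih =>
      intro v r hr
      rw [pow_succ, ← Matrix.mulVec_mulVec, ih _ r hr]
      let V : ℕ → R := fun i => if h : i - 1 < n - 1 ∧ 0 < i then v ⟨i - 1, h.1⟩ else 0
      have hV : v = fun r : Fin (n - 1) => V (r + 1) := by
        funext r
        simp [V]
      have := prod_burauMatrix_mulVec t (n - 2) h (V := V) (by simp [V])
        (by simp [V])
      rw [← hD] at this
      rw [hV, this]
      simp only
      rw [if_neg (by omega)]
  refine Matrix.ext_of_mulVec_single fun i => ?_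
  rw [← Matrix.mulVec_mulVec, Matrix.smul_mulVec]
  have hfix := prod_burauMatrix_pow_mulVec t (n - 2) h (by omega)
    (v := (D ^ (n - 1) - 1) *ᵥ Pi.single i 1) (fun r hr => by
      rw [Matrix.sub_mulVec, Matrix.one_mulVec, Pi.sub_apply, hlast _ _ r hr, sub_self])
  rwa [show n - 2 + 1 = n - 1 by omega] at hfix

/-- The first reduced Burau matrix `a` satisfies `(a + t) (a - 1) = 0`. -/
lemma burauMatrix_zero_mul_sub_one {n : ℕ} (t : R) (h : 0 < n - 1) :
    burauMatrix n R t ⟨0, h⟩ * (burauMatrix n R t ⟨0, h⟩ - 1) =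
      (-t) • (burauMatrix n R t ⟨0, h⟩ - 1) := by
  ext r c
  rw [Matrix.mul_apply, Finset.sum_eq_single ⟨0, h⟩]
  · by_cases hr : r = ⟨0, h⟩
    · subst hr
      simp [burauMatrix]
    · simp [burauMatrix, hr, Matrix.one_apply]
  · intro b _ hb
    simp [burauMatrix, hb, Matrix.one_apply]
  · simp

end Burau

/-- The subgroup `ncl({σ₁^d, τ_{n-1}^j}) · ⟨τ_n^ℓ⟩` lies in the kernel of the reduced Burau
representation of `B_n` specialized at `t = -q`, when `(-q)^{(n-1)j} = 1`, `(-q)^{n-1} ≠ 1`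
and `(-q)^{nℓ} = 1`. -/
theorem ncl_le_ker_specialized_burau
    (n d j l : ℕ) (hn : 3 ≤ n) (hd : 2 ≤ d) (hj : 0 < j) (hl : 0 < l)
    (q : ℂ) (hq : IsPrimitiveRoot q d)
    (h1 : (-q) ^ ((n - 1) * j) = 1) (h2 : (-q) ^ (n - 1) ≠ 1) (h3 : (-q) ^ (n * l) = 1)
    (f : BraidGroup n →* GL (Fin (n - 1)) ℂ)
    (hf : ∀ i, (f (braidGen n i) : Matrix (Fin (n - 1)) (Fin (n - 1)) ℂ) =
      burauMatrix n ℂ (-q) i) :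
    Subgroup.normalClosure {braidGen n ⟨0, by omega⟩ ^ d, subTwist n ^ j} ⊔
      Subgroup.zpowers (fullTwist n ^ l) ≤ f.ker := by
  let g : BraidGroup n →* Matrix (Fin (n - 1)) (Fin (n - 1)) ℂ := (Units.coeHom _).comp f
  have hg : ∀ i, g (braidGen n i) = burauMatrix n ℂ (-q) i := hf
  have mem_ker : ∀ x, g x = 1 → x ∈ f.ker := fun x hx =>
    MonoidHom.mem_ker.mpr (Units.ext hx)
  refine sup_le (Subgroup.normalClosure_le_normal ?_) ?_
  · rintro x (rfl | rfl)
    · refine mem_ker _ ?_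
      rw [map_pow, hg]
      refine pow_eq_one_of_mul_sub_one_eq_smul (s := q) ?_ (hq.ne_one (by omega)) hq.pow_eq_one
      simpa using burauMatrix_zero_mul_sub_one (-q) (show 0 < n - 1 by omega)
    · refine mem_ker _ ?_
      rw [map_pow, subTwist, map_pow, map_list_prod, List.map_ofFn]
      simp only [Function.comp_def, hg]
      exact pow_eq_one_of_mul_sub_one_eq_smul
        (prod_burauMatrix_castLE_pow_mul_sub_one (-q) (by omega) _) h2 (by rw [← pow_mul, h1])
  · rw [Subgroup.zpowers_le]
    refine mem_ker _ ?_
    rw [map_pow, fullTwist, map_pow, map_list_prod, List.map_ofFn]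
    simp only [Function.comp_def, hg]
    rw [prod_burauMatrix_pow _ (by omega), smul_pow, ← pow_mul, h3, one_pow, one_smul]
end

section
/- For each (d, j, ℓ) among (7,14,7), (8,8,4), (9,6,9), (10,5,5), (12,4,3), (18,3,9), the subgroup ncl_{B₄}({σ₁^d, τ₃^j}) · ⟨τ₄^ℓ⟩ has infinite index in the braid group B₄; and for (d, ℓ) equal to (5,5) and (6,3), the subgroup ncl_{B₄}({σ₁^d}) · ⟨τ₄^ℓ⟩ has infinite index in B₄. -/
open Matrix

/-- A complex square matrix of finite order has trace of norm at most its size, since its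
eigenvalues are roots of unity. -/
theorem norm_trace_le_card_of_pow_eq_one {n : Type*} [Fintype n] [DecidableEq n]
    {M : Matrix n n ℂ} {m : ℕ} (hm : m ≠ 0) (hM : M ^ m = 1) :
    ‖M.trace‖ ≤ Fintype.card n := by
  rcases isEmpty_or_nonempty n with hn | hn
  · simp [Matrix.trace]
  have hroot : ∀ μ ∈ M.charpoly.roots, ‖μ‖ ≤ 1 := by
    intro μ hμ
    have hspec : μ ∈ spectrum ℂ M :=
      Matrix.mem_spectrum_iff_isRoot_charpoly.2 (Polynomial.isRoot_of_mem_roots hμ)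
    have hpow := spectrum.pow_mem_pow M m hspec
    rw [hM, spectrum.one_eq, Set.mem_singleton_iff] at hpow
    exact (Complex.norm_eq_one_of_pow_eq_one hpow hm).le
  rw [Matrix.trace_eq_sum_roots_charpoly]
  calc ‖M.charpoly.roots.sum‖ ≤ (M.charpoly.roots.map fun μ => ‖μ‖).sum :=
        norm_multiset_sum_le _
    _ ≤ (M.charpoly.roots.map fun μ => ‖μ‖).card • (1 : ℝ) := by
        refine Multiset.sum_le_card_nsmul _ _ fun x hx => ?_
        obtain ⟨μ, hμ, rfl⟩ := Multiset.mem_map.1 hx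
        exact hroot μ hμ
    _ ≤ Fintype.card n := by
        rw [Multiset.card_map, nsmul_eq_mul, mul_one, Nat.cast_le]
        exact (Polynomial.card_roots' _).trans M.charpoly_natDegree_eq_dim.le

/-- An element annihilated by `(X - 1) (X - a)` with `a ≠ 1` and `a ^ m = 1` has `m`-th power
equal to one. -/
theorem pow_eq_one_of_sub_one_mul_sub_eq_zero {K A : Type*} [Field K] [Ring A] [Algebra K A]
    {M : A} {a : K} {m : ℕ} (ha : a ≠ 1) (ham : a ^ m = 1)
    (hM : (M - 1) * (M - algebraMap K A a) = 0) : M ^ m = 1 := by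
  have hsq : M * M = (a + 1) • M - a • (1 : A) := by
    rw [Algebra.algebraMap_eq_smul_one] at hM
    simp only [sub_mul, mul_sub, smul_sub, mul_smul_comm, mul_one, one_mul] at hM
    rw [add_smul, one_smul, ← sub_eq_zero, ← hM]
    abel
  have key : ∀ k : ℕ, (a - 1) • M ^ k = (a ^ k - 1) • M - (a ^ k - a) • (1 : A) := by
    intro k
    induction k with
    | zero => simp [← neg_smul]
    | succ k ih =>
      rw [pow_succ, ← smul_mul_assoc, ih, sub_mul, smul_mul_assoc, smul_mul_assoc, hsq, one_mul]
      module
  have h := key m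
  rw [ham, sub_self, zero_smul, zero_sub, ← neg_smul, neg_sub] at h
  exact smul_right_injective A (sub_ne_zero.2 ha) h

section Burau

variable {R : Type*} [CommRing R]

theorem burauMatrix_four_zero (t : R) :
    burauMatrix 4 R t 0 = !![-t, 1, 0; 0, 1, 0; 0, 0, 1] := by
  ext i j
  fin_cases i <;> fin_cases j <;> simp [burauMatrix]

theorem burauMatrix_four_one (t : R) :
    burauMatrix 4 R t 1 = !![1, 0, 0; t, -t, 1; 0, 0, 1] := by
  ext i j
  fin_cases i <;> fin_cases j <;> simp [burauMatrix]

theorem burauMatrix_four_two (t : R) :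
    burauMatrix 4 R t 2 = !![1, 0, 0; 0, 1, 0; 0, t, -t] := by
  ext i j
  fin_cases i <;> fin_cases j <;> simp [burauMatrix]

theorem det_burauMatrix_four (t : R) (k : Fin 3) : (burauMatrix 4 R t k).det = -t := by
  fin_cases k
  · exact (congrArg Matrix.det (burauMatrix_four_zero t)).trans (by simp [Matrix.det_fin_three])
  · exact (congrArg Matrix.det (burauMatrix_four_one t)).trans (by simp [Matrix.det_fin_three])
  · exact (congrArg Matrix.det (burauMatrix_four_two t)).trans (by simp [Matrix.det_fin_three])

/-- The reduced Burau matrix of a generator of `B₄` at an invertible parameter, as an element of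
the general linear group. -/
noncomputable def burauUnit (t : Rˣ) (k : Fin (4 - 1)) : GL (Fin (4 - 1)) R :=
  Matrix.GeneralLinearGroup.mk'' (burauMatrix 4 R t k)
    (by rw [det_burauMatrix_four]; exact t.isUnit.neg)

theorem coe_burauUnit (t : Rˣ) (k : Fin (4 - 1)) :
    (burauUnit t k : Matrix (Fin (4 - 1)) (Fin (4 - 1)) R) = burauMatrix 4 R t k := rfl

theorem burauUnit_braid_zero_one (t : Rˣ) :
    burauUnit t 0 * burauUnit t 1 * burauUnit t 0 =
      burauUnit t 1 * burauUnit t 0 * burauUnit t 1 := by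
  apply Units.ext
  simp only [Units.val_mul, coe_burauUnit, burauMatrix_four_zero, burauMatrix_four_one]
  ext i j
  fin_cases i <;> fin_cases j <;> simp [Matrix.mul_apply, Fin.sum_univ_three]

theorem burauUnit_braid_one_two (t : Rˣ) :
    burauUnit t 1 * burauUnit t 2 * burauUnit t 1 =
      burauUnit t 2 * burauUnit t 1 * burauUnit t 2 := by
  apply Units.ext
  simp only [Units.val_mul, coe_burauUnit, burauMatrix_four_one, burauMatrix_four_two]
  ext i j
  fin_cases i <;> fin_cases j <;> simp [Matrix.mul_apply, Fin.sum_univ_three]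

theorem burauUnit_comm_zero_two (t : Rˣ) :
    burauUnit t 0 * burauUnit t 2 = burauUnit t 2 * burauUnit t 0 := by
  apply Units.ext
  simp only [Units.val_mul, coe_burauUnit, burauMatrix_four_zero, burauMatrix_four_two]
  ext i j
  fin_cases i <;> fin_cases j <;> simp [Matrix.mul_apply, Fin.sum_univ_three]

theorem lift_burauUnit_eq_one (t : Rˣ) :
    ∀ r ∈ braidRels (4 - 1), FreeGroup.lift (burauUnit t) r = 1 := by
  rintro r (⟨i, j, hij, rfl⟩ | ⟨i, j, hij, rfl⟩)
  · simp only [map_mul, map_inv, FreeGroup.lift_apply_of, mul_inv_eq_one]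
    have h : (i = 0 ∧ j = 1) ∨ (i = 1 ∧ j = 2) := by
      simp only [Fin.ext_iff]
      have := j.isLt
      change ((i : ℕ) = 0 ∧ (j : ℕ) = 1) ∨ ((i : ℕ) = 1 ∧ (j : ℕ) = 2)
      omega
    rcases h with ⟨rfl, rfl⟩ | ⟨rfl, rfl⟩
    · exact burauUnit_braid_zero_one t
    · exact burauUnit_braid_one_two t
  · simp only [map_mul, map_inv, FreeGroup.lift_apply_of, mul_inv_eq_one]
    have h : i = 0 ∧ j = 2 := by
      simp only [Fin.ext_iff]
      have := j.isLt
      change (i : ℕ) = 0 ∧ (j : ℕ) = 2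
      omega
    obtain ⟨rfl, rfl⟩ := h
    exact burauUnit_comm_zero_two t

/-- The reduced Burau representation of `B₄` at an invertible parameter. -/
noncomputable def burauRep (t : Rˣ) : BraidGroup 4 →* GL (Fin (4 - 1)) R :=
  PresentedGroup.toGroup (lift_burauUnit_eq_one t)

theorem burauRep_braidGen (t : Rˣ) (k : Fin (4 - 1)) :
    burauRep t (braidGen 4 k) = burauUnit t k :=
  PresentedGroup.toGroup.of _

theorem burauRep_subTwist (t : Rˣ) :
    burauRep t (subTwist 4) = (burauUnit t 0 * burauUnit t 1) ^ 3 := by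
  have h : subTwist 4 = (braidGen 4 0 * braidGen 4 1) ^ 3 := by
    simp [subTwist, List.ofFn_succ]
  rw [h, map_pow, map_mul, burauRep_braidGen, burauRep_braidGen]

theorem burauRep_fullTwist (t : Rˣ) :
    burauRep t (fullTwist 4) = (burauUnit t 0 * burauUnit t 1 * burauUnit t 2) ^ 4 := by
  have h : fullTwist 4 = (braidGen 4 0 * braidGen 4 1 * braidGen 4 2) ^ 4 := by
    simp [fullTwist, List.ofFn_succ, mul_assoc]
  rw [h, map_pow, map_mul, map_mul, burauRep_braidGen, burauRep_braidGen, burauRep_braidGen]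

theorem coe_burauRep_subTwist (t : Rˣ) :
    (burauRep t (subTwist 4) : Matrix (Fin (4 - 1)) (Fin (4 - 1)) R) =
      !![(t : R) ^ 3, 0, 1 - (t : R); 0, (t : R) ^ 3, 1 - (t : R) ^ 2; 0, 0, 1] := by
  rw [burauRep_subTwist]
  simp only [Units.val_pow_eq_pow_val, Units.val_mul, coe_burauUnit, burauMatrix_four_zero,
    burauMatrix_four_one]
  ext i j
  fin_cases i <;> fin_cases j <;> simp [pow_succ, Matrix.mul_apply, Fin.sum_univ_three] <;> ring

theorem coe_burauRep_fullTwist (t : Rˣ) :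
    (burauRep t (fullTwist 4) : Matrix (Fin (4 - 1)) (Fin (4 - 1)) R) =
      (t : R) ^ 4 • (1 : Matrix (Fin (4 - 1)) (Fin (4 - 1)) R) := by
  have h : (burauUnit t 0 * burauUnit t 1 * burauUnit t 2 :
      Matrix (Fin (4 - 1)) (Fin (4 - 1)) R) =
      !![0, 0, -(t : R); (t : R), 0, -(t : R); 0, (t : R), -(t : R)] := by
    simp only [coe_burauUnit, burauMatrix_four_zero, burauMatrix_four_one, burauMatrix_four_two]
    ext i j
    fin_cases i <;> fin_cases j <;> simp [Matrix.mul_apply, Fin.sum_univ_three]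
  rw [burauRep_fullTwist, Units.val_pow_eq_pow_val, Units.val_mul, Units.val_mul, h]
  ext i j
  fin_cases i <;> fin_cases j <;>
    simp [pow_succ, Matrix.mul_apply, Fin.sum_univ_three]

theorem burauRep_fullTwist_pow_eq_one {t : Rˣ} {l : ℕ} (ht : (t : R) ^ (4 * l) = 1) :
    burauRep t (fullTwist 4 ^ l) = 1 := by
  apply Units.ext
  rw [map_pow, Units.val_pow_eq_pow_val, coe_burauRep_fullTwist, smul_pow, one_pow, ← pow_mul,
    ht, one_smul, Units.val_one]

theorem trace_burauRep (t : Rˣ) :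
    (burauRep t (braidGen 4 0 * braidGen 4 2 * (braidGen 4 1)⁻¹) :
      Matrix (Fin (4 - 1)) (Fin (4 - 1)) R).trace = 2 - 2 * (t : R) - (↑t⁻¹ : R) := by
  have hinv : ((burauUnit t 1)⁻¹ : GL (Fin (4 - 1)) R).val =
      !![1, 0, 0; 1, -(↑t⁻¹ : R), (↑t⁻¹ : R); 0, 0, 1] := by
    rw [Units.inv_eq_of_mul_eq_one_right]
    rw [coe_burauUnit, burauMatrix_four_one]
    ext i j
    fin_cases i <;> fin_cases j <;> simp [Matrix.mul_apply, Fin.sum_univ_three]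
  simp only [map_mul, map_inv, burauRep_braidGen, Units.val_mul, hinv, coe_burauUnit,
    burauMatrix_four_zero, burauMatrix_four_two]
  simp [Matrix.trace, Fin.sum_univ_three]
  ring

end Burau

theorem burauRep_braidGen_zero_pow_eq_one {K : Type*} [Field K] {t : Kˣ} {d : ℕ}
    (ht : -(t : K) ≠ 1) (htd : (-(t : K)) ^ d = 1) : burauRep t (braidGen 4 0 ^ d) = 1 := by
  apply Units.ext
  rw [map_pow, burauRep_braidGen, Units.val_pow_eq_pow_val, Units.val_one, coe_burauUnit]
  refine pow_eq_one_of_sub_one_mul_sub_eq_zero ht htd ?_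
  rw [burauMatrix_four_zero]
  ext i j
  fin_cases i <;> fin_cases j <;>
    simp [Matrix.mul_apply, Fin.sum_univ_three, Algebra.algebraMap_eq_smul_one]
  ring

theorem burauRep_subTwist_pow_eq_one {K : Type*} [Field K] {t : Kˣ} {j : ℕ}
    (ht : (t : K) ^ 3 ≠ 1) (htj : (t : K) ^ (3 * j) = 1) :
    burauRep t (subTwist 4 ^ j) = 1 := by
  apply Units.ext
  rw [map_pow, Units.val_pow_eq_pow_val, Units.val_one, coe_burauRep_subTwist]
  refine pow_eq_one_of_sub_one_mul_sub_eq_zero ht ((pow_mul _ _ _).symm.trans htj) ?_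
  ext i j
  fin_cases i <;> fin_cases j <;>
    simp [-map_pow, Matrix.mul_apply, Fin.sum_univ_three, Algebra.algebraMap_eq_smul_one] <;>
    ring

theorem three_tenths_le_cos_two_pi_div {d : ℕ} (hd : 5 ≤ d) :
    3 / 10 ≤ Real.cos (2 * Real.pi / d) := by
  have hd' : (5 : ℝ) ≤ d := by exact_mod_cast hd
  have hmono : Real.cos (2 * Real.pi / 5) ≤ Real.cos (2 * Real.pi / d) := by
    apply Real.cos_le_cos_of_nonneg_of_le_pi
    · positivity
    · linarith [Real.pi_pos]
    · gcongr
  have h5 : Real.cos (2 * Real.pi / 5) = 2 * ((1 + √5) / 4) ^ 2 - 1 := by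
    rw [mul_div_assoc, Real.cos_two_mul, Real.cos_pi_div_five]
  have hs : (11 / 5 : ℝ) ≤ √5 := Real.le_sqrt_of_sq_le (by norm_num)
  have hsq : √5 ^ 2 = 5 := Real.sq_sqrt (by norm_num)
  nlinarith

/-- The unit `-exp (2πi / d)` of `ℂ`. -/
noncomputable def burauParam (d : ℕ) : ℂˣ :=
  Units.mk0 (-Complex.exp (2 * Real.pi * Complex.I / d)) (neg_ne_zero.2 (Complex.exp_ne_zero _))

theorem isPrimitiveRoot_neg_burauParam {d : ℕ} (hd : d ≠ 0) :
    IsPrimitiveRoot (-(burauParam d : ℂ)) d := by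
  simpa [burauParam] using Complex.isPrimitiveRoot_exp d hd

theorem burauParam_pow_eq_one_of_even {d k : ℕ} (hd : d ≠ 0) (hk : Even k) (hdk : d ∣ k) :
    (burauParam d : ℂ) ^ k = 1 := by
  rw [← hk.neg_pow]
  exact ((isPrimitiveRoot_neg_burauParam hd).pow_eq_one_iff_dvd _).2 hdk

theorem burauParam_two_mul_pow_eq_one {k : ℕ} (hk : Odd k) :
    (burauParam (2 * k) : ℂ) ^ k = 1 := by
  have hpos : 0 < k := hk.pos
  have h := (isPrimitiveRoot_neg_burauParam (d := 2 * k) (by omega)).pow (by omega)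
    (mul_comm 2 k)
  have h' := h.eq_neg_one_of_two_right
  rwa [hk.neg_pow, neg_inj] at h'

theorem three_lt_norm_of_burauParam {d : ℕ} (hd : 5 ≤ d) :
    3 < ‖2 - 2 * (burauParam d : ℂ) - (↑(burauParam d)⁻¹ : ℂ)‖ := by
  have hexp : Complex.exp (2 * Real.pi * Complex.I / d) =
      Real.cos (2 * Real.pi / d) + Real.sin (2 * Real.pi / d) * Complex.I := by
    rw [Complex.ofReal_cos, Complex.ofReal_sin, ← Complex.exp_mul_I]
    push_cast
    ring_nf
  have hinv : (Complex.exp (2 * Real.pi * Complex.I / d))⁻¹ =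
      Real.cos (2 * Real.pi / d) - Real.sin (2 * Real.pi / d) * Complex.I := by
    rw [← Complex.exp_neg, Complex.ofReal_cos, Complex.ofReal_sin, sub_eq_add_neg, ← neg_mul,
      ← Complex.cos_neg, ← Complex.sin_neg, ← Complex.exp_mul_I]
    push_cast
    ring_nf
  have hc := three_tenths_le_cos_two_pi_div hd
  have hcs := Real.sin_sq_add_cos_sq (2 * Real.pi / d)
  generalize Real.cos (2 * Real.pi / d) = c at *
  generalize Real.sin (2 * Real.pi / d) = s at *
  have hval : 2 - 2 * (burauParam d : ℂ) - (↑(burauParam d)⁻¹ : ℂ) = ⟨2 + 3 * c, s⟩ := by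
    rw [Units.val_inv_eq_inv_val, burauParam, Units.val_mk0, inv_neg, hinv, hexp]
    apply Complex.ext <;> simp <;> ring
  rw [hval]
  refine lt_of_pow_lt_pow_left₀ 2 (norm_nonneg _) ?_
  rw [Complex.sq_norm, Complex.normSq_mk]
  nlinarith

theorem index_ker_burauRep_eq_zero {d : ℕ} (hd : 5 ≤ d) :
    (burauRep (burauParam d)).ker.index = 0 := by
  by_contra hindex
  obtain ⟨m, hm, -, hmem⟩ := Subgroup.exists_pow_mem_of_index_ne_zero hindex
    (braidGen 4 0 * braidGen 4 2 * (braidGen 4 1)⁻¹)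
  rw [MonoidHom.mem_ker, map_pow] at hmem
  have hle := norm_trace_le_card_of_pow_eq_one hm.ne' (congrArg Units.val hmem)
  rw [trace_burauRep] at hle
  have hlt := three_lt_norm_of_burauParam hd
  norm_num [-Units.val_inv_eq_inv_val] at hle
  linarith

theorem index_normalClosure_sup_zpowers_eq_zero {d l : ℕ} {S : Set (BraidGroup 4)} (hd : 5 ≤ d)
    (hl : d ∣ 4 * l) (hS : S ⊆ (burauRep (burauParam d)).ker) :
    (Subgroup.normalClosure S ⊔ Subgroup.zpowers (fullTwist 4 ^ l)).index = 0 := by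
  suffices hle : Subgroup.normalClosure S ⊔ Subgroup.zpowers (fullTwist 4 ^ l) ≤
      (burauRep (burauParam d)).ker from
    Nat.eq_zero_of_zero_dvd (index_ker_burauRep_eq_zero hd ▸ Subgroup.index_dvd_of_le hle)
  refine sup_le (Subgroup.normalClosure_le_normal hS) ?_
  rw [Subgroup.zpowers_le, MonoidHom.mem_ker]
  exact burauRep_fullTwist_pow_eq_one
    (burauParam_pow_eq_one_of_even (by omega) ⟨2 * l, by ring⟩ hl)

theorem braidGen_zero_pow_mem_ker_burauRep {d : ℕ} (hd : 5 ≤ d) :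
    braidGen 4 0 ^ d ∈ (burauRep (burauParam d)).ker := by
  have hprim := isPrimitiveRoot_neg_burauParam (d := d) (by omega)
  exact burauRep_braidGen_zero_pow_eq_one (hprim.ne_one (by omega)) hprim.pow_eq_one

theorem subTwist_pow_mem_ker_burauRep {d j : ℕ} (hd : 7 ≤ d)
    (hj : (burauParam d : ℂ) ^ (3 * j) = 1) :
    subTwist 4 ^ j ∈ (burauRep (burauParam d)).ker := by
  refine burauRep_subTwist_pow_eq_one (fun h => ?_) hj
  refine (isPrimitiveRoot_neg_burauParam (d := d) (by omega)).pow_ne_one_of_pos_of_lt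
    (l := 6) (by norm_num) (by omega) ?_
  rw [Even.neg_pow (by decide), show 6 = 3 * 2 from rfl, pow_mul, h, one_pow]

/-- The subgroups `ncl({σ₁^d, τ₃^j}) · ⟨τ₄^ℓ⟩` (for the listed `(d,j,ℓ)`) and
`ncl({σ₁^d}) · ⟨τ₄^ℓ⟩` (for `(d,ℓ) = (5,5), (6,3)`) all have infinite index in `B₄`
(`Subgroup.index = 0` encodes infinite index). -/
theorem burau4_subgroups_infinite_index :
    (∀ d j l : ℕ,
      (d, j, l) ∈ [(7, 14, 7), (8, 8, 4), (9, 6, 9), (10, 5, 5), (12, 4, 3), (18, 3, 9)] →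
      (Subgroup.normalClosure {braidGen 4 0 ^ d, subTwist 4 ^ j} ⊔
        Subgroup.zpowers (fullTwist 4 ^ l)).index = 0) ∧
    (∀ d l : ℕ, (d, l) ∈ [(5, 5), (6, 3)] →
      (Subgroup.normalClosure {braidGen 4 0 ^ d} ⊔
        Subgroup.zpowers (fullTwist 4 ^ l)).index = 0) := by
  refine ⟨fun d j l h => ?_, fun d l h => ?_⟩
  · have hd : 7 ≤ d ∧ d ∣ 4 * l ∧ (burauParam d : ℂ) ^ (3 * j) = 1 := by
      simp only [List.mem_cons, Prod.mk.injEq, List.not_mem_nil, or_false] at h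
      rcases h with ⟨rfl, rfl, rfl⟩ | ⟨rfl, rfl, rfl⟩ | ⟨rfl, rfl, rfl⟩ | ⟨rfl, rfl, rfl⟩ |
        ⟨rfl, rfl, rfl⟩ | ⟨rfl, rfl, rfl⟩
      · exact ⟨by decide, by decide,
          burauParam_pow_eq_one_of_even (by decide) (by decide) (by decide)⟩
      · exact ⟨by decide, by decide,
          burauParam_pow_eq_one_of_even (by decide) (by decide) (by decide)⟩
      · exact ⟨by decide, by decide,
          burauParam_pow_eq_one_of_even (by decide) (by decide) (by decide)⟩
      · refine ⟨by decide, by decide, ?_⟩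
        have h5 := burauParam_two_mul_pow_eq_one (k := 5) (by decide)
        rw [mul_comm, pow_mul, h5, one_pow]
      · exact ⟨by decide, by decide,
          burauParam_pow_eq_one_of_even (by decide) (by decide) (by decide)⟩
      · exact ⟨by decide, by decide, burauParam_two_mul_pow_eq_one (k := 9) (by decide)⟩
    obtain ⟨hd, hl, hj⟩ := hd
    refine index_normalClosure_sup_zpowers_eq_zero (d := d) (by omega) hl ?_
    exact Set.insert_subset (braidGen_zero_pow_mem_ker_burauRep (by omega))
      (Set.singleton_subset_iff.2 (subTwist_pow_mem_ker_burauRep hd hj))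
  · have hd : 5 ≤ d ∧ d ∣ 4 * l := by
      simp only [List.mem_cons, Prod.mk.injEq, List.not_mem_nil, or_false] at h
      rcases h with ⟨rfl, rfl⟩ | ⟨rfl, rfl⟩ <;> decide
    exact index_normalClosure_sup_zpowers_eq_zero hd.1 hd.2
      (Set.singleton_subset_iff.2 (braidGen_zero_pow_mem_ker_burauRep hd.1))
end

section
/- Fix n ≥ 3 and work in the field ℚ(t) of rational functions over ℚ. For an (n−1)×(n−1) matrix A over ℚ(t), let v(A) = (1/(1−tⁿ)) · (I_{n−1} − A) · (1−t, 1−t², …, 1−t^{n−1})ᵀ. Then for every matrix A in the subgroup of GL_{n−1}(ℚ(t)) generated by the reduced Burau matrices B₁, …, B_{n−1} (whose entries lie in ℤ[t,t⁻¹] ⊂ ℚ(t)), every entry of v(A) lies in the subring ℤ[t,t⁻¹] of Laurent polynomials; equivalently, the affine extension Ã = ((A, v(A)), (0, 1)) is an n×n matrix with entries in ℤ[t,t⁻¹]. -/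
open Matrix

/-- The crossed homomorphism `v(A) = (1/(1-tⁿ)) (I - A) (1-t, …, 1-t^{n-1})ᵀ`, over `ℚ(t)`. -/
noncomputable def burauVec (n : ℕ) (A : Matrix (Fin (n - 1)) (Fin (n - 1)) (RatFunc ℚ)) :
    Fin (n - 1) → RatFunc ℚ :=
  fun i => (1 - RatFunc.X ^ n)⁻¹ *
    ((1 - A).mulVec fun j : Fin (n - 1) => 1 - RatFunc.X ^ ((j : ℕ) + 1)) i

theorem burauVec_one (n : ℕ) : burauVec n 1 = 0 := by
  ext i
  simp [burauVec]

/-- `v` is a crossed homomorphism. -/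
theorem burauVec_mul (n : ℕ) (A B : Matrix (Fin (n - 1)) (Fin (n - 1)) (RatFunc ℚ)) :
    burauVec n (A * B) = burauVec n A + A *ᵥ burauVec n B := by
  have hsmul (C : Matrix (Fin (n - 1)) (Fin (n - 1)) (RatFunc ℚ)) :
      burauVec n C = (1 - RatFunc.X ^ n : RatFunc ℚ)⁻¹ •
        ((1 - C) *ᵥ fun j : Fin (n - 1) => 1 - RatFunc.X ^ ((j : ℕ) + 1)) := rfl
  rw [hsmul, hsmul, hsmul, mulVec_smul, mulVec_mulVec, ← smul_add, ← add_mulVec]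
  congr 3
  noncomm_ring

/-- The product of row `k` of the Burau matrix with a vector `(f 1, …, f (n-1))`, `f 0 = 0`. -/
theorem sum_burauMatrix_row_mul {n : ℕ} {R : Type*} [CommRing R] (t : R) (k : Fin (n - 1))
    (f : ℕ → R) (hf : f 0 = 0) :
    ∑ c, burauMatrix n R t k k c * f ((c : ℕ) + 1) =
      t * f k - t * f (k + 1) + if (k : ℕ) + 2 = n then 0 else f (k + 2) := by
  obtain ⟨k, hk⟩ := k
  let g (c : ℕ) : R := (if c + 1 = k then t * f k else 0) +
    (if c = k then -t * f (k + 1) else 0) + (if c = k + 1 then f (k + 2) else 0)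
  have hterm (c : Fin (n - 1)) :
      burauMatrix n R t ⟨k, hk⟩ ⟨k, hk⟩ c * f ((c : ℕ) + 1) = g c := by
    simp only [g, burauMatrix, of_apply, Fin.ext_iff]
    grind
  rw [Finset.sum_congr rfl fun c _ => hterm c, Fin.sum_univ_eq_sum_range g,
    Finset.sum_add_distrib, Finset.sum_add_distrib]
  have hleft : ∑ c ∈ Finset.range (n - 1), (if c + 1 = k then t * f k else 0) = t * f k := by
    cases k with
    | zero => simp [hf]
    | succ k => simp; grind
  rw [hleft]
  simp
  grind

theorem burauVec_burauMatrix_mem (n : ℕ) (k i : Fin (n - 1)) (S : Subring (RatFunc ℚ)) :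
    burauVec n (burauMatrix n (RatFunc ℚ) RatFunc.X k) i ∈ S := by
  by_cases hik : i = k
  · subst hik
    have hrow := sum_burauMatrix_row_mul (RatFunc.X : RatFunc ℚ) i
      (fun j => 1 - RatFunc.X ^ j) (by simp)
    simp only [burauVec, sub_mulVec, one_mulVec, Pi.sub_apply]
    simp only [mulVec, dotProduct]
    rw [hrow]
    split_ifs with h
    · have hX : (1 - RatFunc.X ^ n : RatFunc ℚ) ≠ 0 := by
        have hpoly : (Polynomial.X ^ n - 1 : Polynomial ℚ) ≠ 0 :=
          Polynomial.X_pow_sub_C_ne_zero (by omega) 1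
        have := RatFunc.algebraMap_ne_zero hpoly
        rw [map_sub, map_pow, RatFunc.algebraMap_X, map_one] at this
        exact fun h0 => this (by rw [← neg_sub, h0, neg_zero])
      have : (1 - RatFunc.X ^ n : RatFunc ℚ)⁻¹ * (1 - RatFunc.X ^ ((i : ℕ) + 1) -
          (RatFunc.X * (1 - RatFunc.X ^ (i : ℕ)) - RatFunc.X * (1 - RatFunc.X ^ ((i : ℕ) + 1)) + 0))
          = 1 := by
        have hpow := congrArg (fun m => (RatFunc.X : RatFunc ℚ) ^ m) h
        rw [inv_mul_eq_one₀ hX]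
        linear_combination hpow
      rw [this]
      exact S.one_mem
    · convert S.zero_mem
      ring
  · have hzero : burauVec n (burauMatrix n (RatFunc ℚ) RatFunc.X k) i = 0 := by
      simp [burauVec, mulVec, dotProduct, burauMatrix, hik, one_apply]
    rw [hzero]
    exact S.zero_mem

/-- The quadratic relation `(B - 1)(B + t) = 0` of the Hecke algebra. -/
theorem burauMatrix_quadratic {n : ℕ} {R : Type*} [CommRing R] (t : R) (k : Fin (n - 1)) :
    (burauMatrix n R t k - 1) * (burauMatrix n R t k + t • 1) = 0 := by
  have hrank : burauMatrix n R t k - 1 =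
      vecMulVec (Pi.single k 1) ((burauMatrix n R t k - 1) k) := by
    ext r c
    by_cases hr : r = k
    · subst hr; simp [vecMulVec_apply]
    · simp [vecMulVec_apply, burauMatrix, hr, one_apply]
  have hdot : (burauMatrix n R t k - 1) k ⬝ᵥ Pi.single k 1 = -(1 + t) := by
    simp [burauMatrix]
    ring
  have hsq : (burauMatrix n R t k - 1) * (burauMatrix n R t k - 1) =
      -(1 + t) • (burauMatrix n R t k - 1) := by
    rw [hrank, vecMulVec_mul_vecMulVec, ← hrank, hdot, vecMulVec_smul, ← hrank]
  have hsplit : burauMatrix n R t k + t • 1 =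
      (burauMatrix n R t k - 1) + (1 + t) • (1 : Matrix _ _ R) := by
    rw [add_smul, one_smul]
    abel
  rw [hsplit, mul_add, hsq, mul_smul_comm, mul_one, neg_smul, neg_add_cancel]

/-- The inverse of a Burau matrix is `t⁻¹ (B - (1 - t))`. -/
theorem inv_eq_of_coe_eq_burauMatrix {n : ℕ} {K : Type*} [Field K] {t : K} (ht : t ≠ 0)
    {g : GL (Fin (n - 1)) K} {k : Fin (n - 1)} (hg : (g : Matrix _ _ K) = burauMatrix n K t k) :
    ((g⁻¹ : GL (Fin (n - 1)) K) : Matrix _ _ K) = t⁻¹ • (burauMatrix n K t k - (1 - t) • 1) := by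
  refine Units.inv_eq_of_mul_eq_one_right ?_
  rw [hg, mul_smul_comm, inv_smul_eq_iff₀ ht, ← sub_eq_zero, ← burauMatrix_quadratic t k]
  simp only [mul_sub, sub_mul, mul_add, mul_smul_comm, mul_one, one_mul, sub_smul, one_smul,
    smul_sub]
  abel

theorem burauMatrix_mem_matrix {n : ℕ} {R : Type*} [CommRing R] {S : Subring R} {t : R}
    (ht : t ∈ S) (k : Fin (n - 1)) : burauMatrix n R t k ∈ S.matrix := by
  intro r c
  simp only [burauMatrix, of_apply]
  split_ifs <;> simp [ht]

theorem mulVec_mem_of_mem_matrix {m R : Type*} [Fintype m] [DecidableEq m] [CommRing R]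
    {S : Subring R} {A : Matrix m m R} (hA : A ∈ S.matrix) {w : m → R} (hw : ∀ i, w i ∈ S) (i : m) :
    (A *ᵥ w) i ∈ S :=
  S.sum_mem fun j _ => S.mul_mem (hA i j) (hw j)

/-- For any `A` in the subgroup of `GL_{n-1}(ℚ(t))` generated by the reduced Burau matrices,
every entry of `v(A)` lies in the subring `ℤ[t,t⁻¹]` of Laurent polynomials, i.e. in the
subring of `ℚ(t)` generated by `t` and `t⁻¹`. -/
theorem burauVec_mem_laurent_subring (n : ℕ) (hn : 3 ≤ n)
    (A : GL (Fin (n - 1)) (RatFunc ℚ))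
    (hA : A ∈ Subgroup.closure {g : GL (Fin (n - 1)) (RatFunc ℚ) |
      ∃ i, (g : Matrix (Fin (n - 1)) (Fin (n - 1)) (RatFunc ℚ)) =
        burauMatrix n (RatFunc ℚ) RatFunc.X i}) :
    ∀ i, burauVec n (A : Matrix (Fin (n - 1)) (Fin (n - 1)) (RatFunc ℚ)) i ∈
      Subring.closure {RatFunc.X, RatFunc.X⁻¹} := by
  set S : Subring (RatFunc ℚ) := Subring.closure {RatFunc.X, RatFunc.X⁻¹}
  have hX : RatFunc.X ∈ S := Subring.subset_closure (by simp)
  have hXinv : RatFunc.X⁻¹ ∈ S := Subring.subset_closure (by simp)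
  suffices h : (A : Matrix (Fin (n - 1)) (Fin (n - 1)) (RatFunc ℚ)) ∈ S.matrix ∧
      ((A⁻¹ : GL (Fin (n - 1)) (RatFunc ℚ)) :
        Matrix (Fin (n - 1)) (Fin (n - 1)) (RatFunc ℚ)) ∈ S.matrix ∧
      ∀ i, burauVec n A i ∈ S from h.2.2
  induction hA using Subgroup.closure_induction with
  | mem g hg =>
    obtain ⟨k, hk⟩ := hg
    rw [inv_eq_of_coe_eq_burauMatrix RatFunc.X_ne_zero hk, hk]
    have hB := burauMatrix_mem_matrix hX k
    refine ⟨hB, fun i j => S.mul_mem hXinv (S.sub_mem (hB i j) (S.mul_mem (S.sub_mem S.one_mem hX)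
      (S.matrix.one_mem i j))), fun i => burauVec_burauMatrix_mem n k i S⟩
  | one =>
    rw [inv_one, Units.val_one, burauVec_one]
    exact ⟨one_mem _, one_mem _, fun _ => S.zero_mem⟩
  | mul A B _ _ hA hB =>
    rw [_root_.mul_inv_rev, Units.val_mul, Units.val_mul, burauVec_mul]
    exact ⟨mul_mem hA.1 hB.1, mul_mem hB.2.1 hA.2.1,
      fun i => S.add_mem (hA.2.2 i) (mulVec_mem_of_mem_matrix hA.1 hB.2.2 i)⟩
  | inv A _ hA =>
    rw [inv_inv]
    refine ⟨hA.2.1, hA.1, fun i => ?_⟩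
    have hcocycle := burauVec_mul n ((A⁻¹ : GL (Fin (n - 1)) (RatFunc ℚ)) : Matrix _ _ _) A
    rw [← Units.val_mul, inv_mul_cancel, Units.val_one, burauVec_one] at hcocycle
    rw [eq_neg_of_add_eq_zero_left hcocycle.symm]
    exact S.neg_mem (mulVec_mem_of_mem_matrix hA.2.1 hA.2.2 i)
end

section
/- Fix n ≥ 3 and let B₁, …, B_{n−1} be the reduced Burau matrices over the Laurent polynomial ring ℤ[t,t⁻¹]. Then (B₁ B₂ ⋯ B_{n−2})^{n−1} equals the (n−1)×(n−1) matrix whose (i,i)-entry is t^{n−1} for 1 ≤ i ≤ n−2, whose (i, n−1)-entry is 1 − tⁱ for 1 ≤ i ≤ n−2, whose (n−1, n−1)-entry is 1, and whose remaining entries are 0. (This is the image under the reduced Burau representation of the full twist τ_{n−1} = (σ₁⋯σ_{n−2})^{n−1} on the first n−1 strands.) -/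
open Matrix

/-- The standard basis row vectors of `R^m`, with index shifted by one, so that
`shiftedBasis R m 0 = 0` and `shiftedBasis R m (m + 1) = 0` at the two ends. -/
def shiftedBasis (R : Type*) [CommRing R] (m k : ℕ) : Fin m → R :=
  fun j => if (j : ℕ) + 1 = k then 1 else 0

section

variable {R : Type*} [CommRing R]

lemma shiftedBasis_zero (m : ℕ) : shiftedBasis R m 0 = 0 := by
  ext j
  simp [shiftedBasis]

lemma shiftedBasis_succ_vecMul {m : ℕ} (k : Fin m) (A : Matrix (Fin m) (Fin m) R) :
    shiftedBasis R m (k + 1) ᵥ* A = A k := by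
  have h : shiftedBasis R m (k + 1) = Pi.single k 1 := by
    ext j
    simp [shiftedBasis, Pi.single_apply, Fin.ext_iff]
  rw [h, Matrix.single_one_vecMul]
  rfl

lemma shiftedBasis_vecMul_burauMatrix_self {n : ℕ} (t : R) (k : Fin (n - 1)) :
    shiftedBasis R (n - 1) (k + 1) ᵥ* burauMatrix n R t k =
      t • shiftedBasis R (n - 1) k - t • shiftedBasis R (n - 1) (k + 1) +
        shiftedBasis R (n - 1) (k + 2) := by
  rw [shiftedBasis_succ_vecMul]
  ext c
  simp only [burauMatrix, shiftedBasis, Matrix.of_apply, Pi.add_apply, Pi.sub_apply,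
    Pi.smul_apply, smul_eq_mul, Fin.ext_iff]
  split_ifs <;> first | omega | simp

lemma shiftedBasis_vecMul_burauMatrix_of_ne {n : ℕ} (t : R) (k : Fin (n - 1)) {r : ℕ}
    (hr : r ≤ n - 1) (hrk : r ≠ k + 1) :
    shiftedBasis R (n - 1) r ᵥ* burauMatrix n R t k = shiftedBasis R (n - 1) r := by
  obtain _ | r := r
  · simp [shiftedBasis_zero]
  · have h := shiftedBasis_succ_vecMul (⟨r, hr⟩ : Fin (n - 1)) (burauMatrix n R t k)
    simp only at h
    rw [h]
    ext c
    simp only [burauMatrix, shiftedBasis, Matrix.of_apply, Fin.ext_iff]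
    split_ifs <;> first | omega | rfl

lemma shiftedBasis_vecMul_prod_burauMatrix_of_lt {n : ℕ} (t : R) {j r : ℕ} (hj : j ≤ n - 1)
    (hr : r ≤ n - 1) (hjr : j < r) :
    shiftedBasis R (n - 1) r ᵥ*
        (List.ofFn fun i : Fin j => burauMatrix n R t (Fin.castLE hj i)).prod =
      shiftedBasis R (n - 1) r := by
  induction j with
  | zero => simp
  | succ j ih =>
    rw [List.ofFn_succ', List.concat_eq_append, List.prod_append, List.prod_singleton,
      ← Matrix.vecMul_vecMul]
    erw [ih (by omega) (by omega)]
    exact shiftedBasis_vecMul_burauMatrix_of_ne t _ hr (by simp; omega)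

lemma shiftedBasis_vecMul_prod_burauMatrix {n : ℕ} (t : R) {j r : ℕ} (hj : j < n - 1)
    (hrj : r < j) :
    shiftedBasis R (n - 1) (r + 1) ᵥ*
        (List.ofFn fun i : Fin j => burauMatrix n R t (Fin.castLE hj.le i)).prod =
      t • shiftedBasis R (n - 1) r - t • shiftedBasis R (n - 1) j +
        shiftedBasis R (n - 1) (j + 1) := by
  induction j with
  | zero => omega
  | succ j ih =>
    rw [List.ofFn_succ', List.concat_eq_append, List.prod_append, List.prod_singleton,
      ← Matrix.vecMul_vecMul]
    have hself := shiftedBasis_vecMul_burauMatrix_self t (⟨j, by omega⟩ : Fin (n - 1))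
    have hne {s : ℕ} (hs : s ≤ j) :=
      shiftedBasis_vecMul_burauMatrix_of_ne t (⟨j, by omega⟩ : Fin (n - 1)) (r := s)
        (by omega) (by simp; omega)
    have hlast : Fin.castLE hj.le (Fin.last j) = ⟨j, by omega⟩ := rfl
    simp only at hself
    rw [hlast]
    obtain hr | rfl := Nat.lt_succ_iff_lt_or_eq.mp hrj
    · erw [ih (by omega) hr]
      rw [Matrix.add_vecMul, Matrix.sub_vecMul, Matrix.smul_vecMul, Matrix.smul_vecMul,
        hne hr.le, hne le_rfl, hself]
      abel
    · erw [shiftedBasis_vecMul_prod_burauMatrix_of_lt t (by omega) (by omega) (Nat.lt_succ_self _)]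
      rw [hself]

lemma vecMul_pow_eq_self {m : ℕ} {v : Fin m → R} {M : Matrix (Fin m) (Fin m) R}
    (h : v ᵥ* M = v) (s : ℕ) : v ᵥ* M ^ s = v := by
  induction s with
  | zero => simp
  | succ s ih => rw [pow_succ, ← Matrix.vecMul_vecMul, ih, h]

/-- A matrix `M` acting on row vectors `e 0 = 0, e 1, …, e (p + 1)` as the Burau image of
`σ₁⋯σ_p` does acts through its `(p + 1)`-st power as the full twist. -/
lemma vecMul_pow_succ_of_burau_action {m p : ℕ} (t : R) (e : ℕ → Fin m → R)
    (M : Matrix (Fin m) (Fin m) R) (h0 : e 0 = 0) (hlast : e (p + 1) ᵥ* M = e (p + 1))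
    (hM : ∀ r < p, e (r + 1) ᵥ* M = t • e r - t • e p + e (p + 1)) {r : ℕ} (hr : r ≤ p) :
    e r ᵥ* M ^ (p + 1) = t ^ (p + 1) • e r + (1 - t ^ r) • e (p + 1) := by
  have hdiff (s : ℕ) : ∀ r, r + s < p →
      (e (r + s + 1) - e (r + s)) ᵥ* M ^ s = t ^ s • (e (r + 1) - e r) := by
    induction s with
    | zero => simp
    | succ s ih =>
      intro r hrs
      rw [pow_succ, ← Matrix.vecMul_vecMul, show r + (s + 1) = r + 1 + s by ring,
        ih (r + 1) (by omega), Matrix.smul_vecMul, Matrix.sub_vecMul, hM _ (by omega),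
        hM _ (by omega)]
      module
  induction r with
  | zero => simp [h0]
  | succ r ih =>
    obtain ⟨q, rfl⟩ := Nat.exists_eq_add_of_lt hr
    have hstep : (e (r + 1) - e r) ᵥ* M ^ (r + q + 1 + 1) =
        t ^ (r + q + 1 + 1) • (e (r + 1) - e r) +
          (t ^ r * (1 - t)) • e (r + q + 1 + 1) := by
      have hdown := hdiff r 0 (by omega)
      have hup := hdiff q r (by omega)
      have hone : e 1 ᵥ* M = e (r + q + 1 + 1) - t • e (r + q + 1) := by
        rw [hM 0 (by omega), h0]
        module
      have htop := hM (r + q) (by omega)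
      simp only [zero_add] at hdown
      rw [show r + q + 1 + 1 = r + (1 + (1 + q)) by ring, pow_add M r, pow_add M 1,
        pow_add M 1, pow_one, ← Matrix.vecMul_vecMul, hdown, ← Matrix.vecMul_vecMul,
        ← Matrix.vecMul_vecMul, h0, sub_zero, Matrix.smul_vecMul, hone, Matrix.smul_vecMul,
        Matrix.sub_vecMul, hlast, Matrix.smul_vecMul t, htop]
      have hsplit : t ^ r • (e (r + q + 1 + 1) - t • (t • e (r + q) - t • e (r + q + 1) +
          e (r + q + 1 + 1))) =
          t ^ (r + 2) • (e (r + q + 1) - e (r + q)) +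
            (t ^ r * (1 - t)) • e (r + q + 1 + 1) := by
        module
      rw [hsplit, Matrix.add_vecMul, Matrix.smul_vecMul, Matrix.smul_vecMul, hup,
        vecMul_pow_eq_self hlast,
        show r + (1 + (1 + q)) = r + q + 1 + 1 by ring]
      module
    rw [← sub_add_cancel (e (r + 1)) (e r), Matrix.add_vecMul, hstep, ih (by omega)]
    module

end

/-- The image of the full twist `τ_{n-1} = (σ₁⋯σ_{n-2})^{n-1}` on the first `n-1` strands
under the reduced Burau representation over `ℤ[t,t⁻¹]`: diagonal entries `t^{n-1}` in the
first `n-2` positions and `1` in the last, last-column entries `1 - tⁱ`, zeros elsewhere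
(stated in 0-indexed form: the `(i,i)`-entry is `t^{n-1}` for `i < n-2`, the `(n-2,n-2)`-entry
is `1`, the `(i,n-2)`-entry is `1 - t^{i+1}` for `i < n-2`, and all other entries vanish). -/
theorem burau_subTwist_eq (n : ℕ) (hn : 3 ≤ n) :
    ((List.ofFn fun i : Fin (n - 2) =>
      burauMatrix n (LaurentPolynomial ℤ) (LaurentPolynomial.T 1)
        (Fin.castLE (by omega) i)).prod) ^ (n - 1) =
    Matrix.of fun i j : Fin (n - 1) =>
      if i = j then
        (if (i : ℕ) < n - 2 then (LaurentPolynomial.T 1 : LaurentPolynomial ℤ) ^ (n - 1) else 1)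
      else if (i : ℕ) < n - 2 ∧ (j : ℕ) = n - 2 then
        1 - (LaurentPolynomial.T 1 : LaurentPolynomial ℤ) ^ ((i : ℕ) + 1)
      else 0 := by
  obtain ⟨p, rfl⟩ := Nat.exists_eq_add_of_le' (show 2 ≤ n by omega)
  set t : LaurentPolynomial ℤ := LaurentPolynomial.T 1
  set M := (List.ofFn fun i : Fin (p + 2 - 2) =>
    burauMatrix (p + 2) (LaurentPolynomial ℤ) t (Fin.castLE (by omega) i)).prod
  let e := shiftedBasis (LaurentPolynomial ℤ) (p + 2 - 1)
  have hlast : e (p + 1) ᵥ* M = e (p + 1) :=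
    shiftedBasis_vecMul_prod_burauMatrix_of_lt t (by omega) (by omega) (by omega)
  have hM (r : ℕ) (hr : r < p) : e (r + 1) ᵥ* M = t • e r - t • e p + e (p + 1) :=
    shiftedBasis_vecMul_prod_burauMatrix t (by omega) hr
  ext1 i j
  have hi := i.isLt
  have hj := j.isLt
  rw [← shiftedBasis_succ_vecMul i (M ^ (p + 2 - 1))]
  change (e (i + 1) ᵥ* M ^ (p + 1)) j = _
  obtain hip | hip := Nat.lt_or_ge (i : ℕ) p
  · rw [vecMul_pow_succ_of_burau_action t e M (shiftedBasis_zero _) hlast hM hip]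
    simp only [e, shiftedBasis, Matrix.of_apply, Pi.add_apply, Pi.smul_apply, smul_eq_mul,
      Fin.ext_iff]
    split_ifs <;> first | omega | simp
  · rw [show (i : ℕ) = p by omega, vecMul_pow_eq_self hlast]
    simp only [e, shiftedBasis, Matrix.of_apply, Fin.ext_iff]
    split_ifs <;> first | omega | rfl
end

section
/- In the braid group B₄, the element τ₃¹⁰ lies in the normal closure ncl_{B₄}({σ₁⁵, τ₄⁵}), where τ₃ = (σ₁σ₂)³ and τ₄ = (σ₁σ₂σ₃)⁴. -/
open Matrix

/-- In a group where `x² = y³` and `(y⁻¹x)⁵ = 1`, the central element `y³` has order dividing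
`10`. The element `g = (xyx)y⁻¹(xyx)y⁻¹x` satisfies `y g y = (y³)⁴ g`; conjugating `y⁻¹` by `g` and
cubing then gives the result. -/
theorem pow_thirty_eq_one_of_sq_eq_cube {G : Type*} [Group G] {x y : G} (hxy : x ^ 2 = y ^ 3)
    (h : (y⁻¹ * x) ^ 5 = 1) : y ^ 30 = 1 := by
  obtain ⟨c, hc⟩ : ∃ c, c = y ^ 3 := ⟨_, rfl⟩
  obtain ⟨i, hi⟩ : ∃ i, i = y⁻¹ := ⟨_, rfl⟩
  have hyc : y * c = c * y := by rw [hc]; group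
  have hic : i * c = c * i := by rw [hc, hi]; group
  have hxc : x * c = c * x := by rw [hc, ← hxy]; group
  have hyc' (t : G) : y * (c * t) = c * (y * t) := by rw [← mul_assoc, hyc, mul_assoc]
  have hic' (t : G) : i * (c * t) = c * (i * t) := by rw [← mul_assoc, hic, mul_assoc]
  have hxc' (t : G) : x * (c * t) = c * (x * t) := by rw [← mul_assoc, hxc, mul_assoc]
  have hxx (t : G) : x * (x * t) = c * t := by rw [← mul_assoc, ← sq, hxy, hc]
  have hyi (t : G) : y * (i * t) = t := by simp [hi]
  have hiy (t : G) : i * (y * t) = t := by simp [hi]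
  have hii (t : G) : c * (i * (i * t)) = y * t := by rw [hc, hi]; group
  have hP (t : G) : x * (y * (x * (y * (x * t)))) =
      c * (c * (c * (i * (x * (i * (x * (i * t))))))) := by
    have h₁ (s : G) : i * (x * (i * (x * (i * (x * (i * (x * (i * (x * s))))))))) = s := by
      have h₂ := congrArg (· * s) h
      simpa [pow_succ, mul_assoc, hi] using h₂
    have h₂ := h₁ (x * (y * (x * (y * (x * t)))))
    simp only [hxx, hxc', hic', hiy] at h₂
    exact h₂.symm
  have hxyx (t : G) : x * (y * (x * t)) =
      c * (c * (i * (x * (i * (x * (i * (x * (i * t)))))))) := by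
    have h₁ := hP (x * (i * t))
    simp only [hxx, hxc', hyc', hyi] at h₁
    exact mul_left_cancel h₁
  have hv (t : G) : x * (y * (x * (i * (x * (y * (x * t)))))) =
      c * (c * (c * (i * (x * (i * (x * (y * (x * (i * (x * (i * t))))))))))) := by
    have h₁ (s : G) : c * (x * (y * (x * (i * (i * s))))) = x * (y * (x * (y * s))) := by
      rw [← hii s]
      simp only [hxc', hyc']
    have h₂ (s : G) : c * (i * (x * (i * (x * (i * (i * s)))))) =
        i * (x * (i * (x * (y * s)))) := by
      rw [← hii s]
      simp only [hxc', hic']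
    rw [hxyx t]
    simp only [hxc', hyc', hic']
    rw [h₁, hP, h₂]
  have hg : y * (x * (y * (x * (i * (x * (y * (x * (i * (x * y))))))))) =
      c * (c * (c * (c * (x * (y * (x * (i * (x * (y * (x * (i * x))))))))))) := by
    have h₁ (s : G) : c * (x * (i * (x * (y * (x * (i * (x * (i * (i * s))))))))) =
        x * (i * (x * (y * (x * (i * (x * (y * s))))))) := by
      rw [← hii s]
      simp only [hxc', hyc', hic']
    have h₂ (s : G) : c * (x * (i * (i * s))) = x * (y * s) := by
      rw [← hii s]
      simp only [hxc']
    rw [hv]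
    simp only [hyc', hyi]
    rw [h₁, hv y]
    simp only [hxc', hic']
    rw [h₂, hi, inv_mul_cancel, mul_one]
  obtain ⟨g, hgdef⟩ : ∃ g, g = x * y * x * i * x * y * x * i * x := ⟨_, rfl⟩
  have hyg : y * g * y = c ^ 4 * g := by
    simpa [hgdef, pow_succ, mul_assoc] using hg
  have hconj : g * y⁻¹ * g⁻¹ = (c ^ 4)⁻¹ * y := by
    rw [mul_inv_eq_iff_eq_mul, mul_inv_eq_iff_eq_mul, mul_assoc, mul_assoc, ← mul_assoc y, hyg,
      inv_mul_cancel_left]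
  have hgc : g * c = c * g := by
    simp only [hgdef, mul_assoc, hxc, hxc', hyc', hic']
  have hcube : c⁻¹ = (c ^ 4)⁻¹ ^ 3 * c := by
    have h₁ := congrArg (· ^ 3) hconj
    have h₂ : Commute (c ^ 4)⁻¹ y := ((show Commute c y from hyc.symm).pow_left 4).inv_left
    simp only [conj_pow, h₂.mul_pow, inv_pow y, ← hc] at h₁
    rwa [((show Commute g c from hgc).inv_right).eq, mul_inv_cancel_right] at h₁
  have hc10 : c ^ 10 = 1 := by
    calc c ^ 10 = c ^ 11 * c⁻¹ := by group
      _ = c ^ 11 * ((c ^ 4)⁻¹ ^ 3 * c) := by rw [← hcube]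
      _ = 1 := by group
  rw [← hc10, hc, ← pow_mul]

/-- If `a` and `b` satisfy the braid relation and `a⁵ = 1`, then `((ab)³)¹⁰ = 1`. -/
theorem braid_cube_pow_ten_eq_one {G : Type*} [Group G] {a b : G}
    (hab : a * b * a = b * a * b) (ha : a ^ 5 = 1) : ((a * b) ^ 3) ^ 10 = 1 := by
  rw [← pow_mul]
  refine pow_thirty_eq_one_of_sq_eq_cube (x := a * b * a) ?_ (by simpa [mul_assoc] using ha)
  calc (a * b * a) ^ 2 = a * b * a * (a * b * a) := sq _
    _ = a * b * a * (b * a * b) := by rw [hab]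
    _ = (a * b) ^ 3 := by simp only [pow_succ, pow_zero, one_mul, mul_assoc]

theorem braidGen_four_braid :
    braidGen 4 0 * braidGen 4 1 * braidGen 4 0 = braidGen 4 1 * braidGen 4 0 * braidGen 4 1 := by
  have h : PresentedGroup.mk (braidRels 3) _ = 1 :=
    PresentedGroup.one_of_mem (rels := braidRels 3) (Or.inl ⟨0, 1, rfl, rfl⟩)
  rw [map_mul, map_inv, mul_inv_eq_one] at h
  exact h

/-- In `B₄`, the element `τ₃¹⁰` lies in the normal closure of `{σ₁⁵, τ₄⁵}`, where
`τ₃ = (σ₁σ₂)³` and `τ₄ = (σ₁σ₂σ₃)⁴`. -/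
theorem subTwist_pow_ten_mem_normalClosure :
    subTwist 4 ^ 10 ∈
      Subgroup.normalClosure {braidGen 4 0 ^ 5, fullTwist 4 ^ 5} := by
  have hsub : subTwist 4 = (braidGen 4 0 * braidGen 4 1) ^ 3 := by
    simp [subTwist, List.ofFn_succ, Fin.castLE]
  set N := Subgroup.normalClosure {braidGen 4 0 ^ 5, fullTwist 4 ^ 5}
  have ha : QuotientGroup.mk' N (braidGen 4 0) ^ 5 = 1 := by
    rw [← map_pow, ← MonoidHom.mem_ker, QuotientGroup.ker_mk']
    exact Subgroup.subset_normalClosure (Set.mem_insert _ _)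
  rw [← QuotientGroup.ker_mk' N, MonoidHom.mem_ker, hsub, map_pow, map_pow, map_mul]
  refine braid_cube_pow_ten_eq_one ?_ ha
  simpa only [map_mul] using congrArg (QuotientGroup.mk' N) braidGen_four_braid
end

section
/- Let (n, d) be one of (4, 6), (5, 4), (7, 3), and let q ∈ ℂ be a primitive d-th root of unity. Let B₁(−q), …, B_{n−2}(−q) denote the reduced Burau matrices over ℂ with t = −q. Then the matrix M = (B₁(−q) ⋯ B_{n−2}(−q))^{n−1} (the image of the full twist τ_{n−1} under the reduced Burau representation specialized at t = −q) has infinite order in GL_{n−1}(ℂ): M^m ≠ I_{n−1} for every positive integer m. -/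
open Matrix

/-- The vector with entries `f 1, …, f (n - 1)`. The value `f 0` stands for the missing entry to
the left of the first one. -/
def shiftedVec {R : Type*} (n : ℕ) (f : ℕ → R) : Fin (n - 1) → R := fun c => f (c + 1)

theorem burauMatrix_mulVec_self {R : Type*} [CommRing R] {n : ℕ} (t : R) {f : ℕ → R}
    (hf : f 0 = 0) (k : Fin (n - 1)) (hk : (k : ℕ) + 1 < n - 1) :
    (burauMatrix n R t k *ᵥ shiftedVec n f) k = t * f k - t * f (k + 1) + f (k + 2) := by
  obtain ⟨k, hkn⟩ := k
  have hsum : (burauMatrix n R t ⟨k, hkn⟩ *ᵥ shiftedVec n f) ⟨k, hkn⟩ =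
      ∑ c ∈ Finset.range (n - 1), ((if c + 1 = k then t * f (c + 1) else 0) +
        (if c = k then -t * f (c + 1) else 0) + if c = k + 1 then f (c + 1) else 0) := by
    rw [← Fin.sum_univ_eq_sum_range, Matrix.mulVec, dotProduct]
    refine Finset.sum_congr rfl fun c _ => ?_
    simp only [burauMatrix, shiftedVec, Matrix.of_apply, if_true, Fin.ext_iff]
    split_ifs <;> first | omega | ring
  rw [hsum, Finset.sum_add_distrib, Finset.sum_add_distrib, Finset.sum_ite_eq',
    Finset.sum_ite_eq', if_pos (Finset.mem_range.2 hkn), if_pos (Finset.mem_range.2 hk)]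
  have hleft : ∑ c ∈ Finset.range (n - 1), (if c + 1 = k then t * f (c + 1) else 0) = t * f k := by
    cases k with
    | zero => simp [hf]
    | succ j =>
      simp only [Nat.add_right_cancel_iff]
      rw [Finset.sum_ite_eq', if_pos (Finset.mem_range.2 (by omega))]
  rw [hleft]
  ring

theorem burauMatrix_mulVec_of_ne {R : Type*} [CommRing R] {n : ℕ} (t : R) (v : Fin (n - 1) → R)
    {k r : Fin (n - 1)} (hr : r ≠ k) : (burauMatrix n R t k *ᵥ v) r = v r := by
  simp [burauMatrix, Matrix.mulVec, dotProduct, hr]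

/-- The product `B₁ ⋯ B_m` maps `f` to `g` when the two agree after position `m` and `g` satisfies
the Burau recursion up to position `m`. -/
theorem prod_burauMatrix_mulVec_s18 {R : Type*} [CommRing R] {n : ℕ} (t : R) {f g : ℕ → R}
    (hf : f 0 = 0) (m : ℕ) (hm : m ≤ n - 1) (hmn : m ≤ n - 2)
    (hfg : ∀ k < m, g (k + 1) = t * f k - t * f (k + 1) + g (k + 2)) :
    (List.ofFn fun i : Fin m => burauMatrix n R t (Fin.castLE hm i)).prod *ᵥ
      shiftedVec n (fun i => if i ≤ m then f i else g i) = shiftedVec n g := by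
  induction m with
  | zero => ext c; simp [shiftedVec]
  | succ m ih =>
    rw [List.ofFn_succ', List.concat_eq_append, List.prod_append, List.prod_singleton,
      ← Matrix.mulVec_mulVec]
    refine Eq.trans ?_ (ih (by omega) (by omega) fun k hk => hfg k (by omega))
    congr 1
    ext r
    by_cases hr : r = Fin.castLE hm (Fin.last m)
    · rw [hr, burauMatrix_mulVec_self t (by simp [hf]) _ (by simp; omega)]
      simp [shiftedVec, hfg m (by omega)]
    · have hrm : (r : ℕ) ≠ m := fun h => hr (Fin.ext (by simpa using h))
      rw [burauMatrix_mulVec_of_ne t _ hr]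
      simp only [shiftedVec]
      split_ifs <;> first | rfl | omega

theorem pow_mulVec_of_mulVec_eq_sub {R ι : Type*} [CommRing R] [Fintype ι] [DecidableEq ι]
    {A : Matrix ι ι R} {u x : ι → R} (hu : A *ᵥ u = u) (hx : A *ᵥ x = x - u) (k : ℕ) :
    (A ^ k) *ᵥ x = x - (k : R) • u := by
  induction k with
  | zero => simp
  | succ k ih =>
    rw [pow_succ', ← Matrix.mulVec_mulVec, ih, Matrix.mulVec_sub, Matrix.mulVec_smul, hu, hx]
    push_cast
    module

/-- If `1 + t + ⋯ + t^(n-2) = 0`, then `B₁(t) ⋯ B_{n-2}(t)` has a nontrivial Jordan block for the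
eigenvalue `1`, hence infinite order in characteristic zero. -/
theorem prod_burauMatrix_pow_ne_one {R : Type*} [CommRing R] [CharZero R] {n : ℕ} (hn : 3 ≤ n)
    (hle : n - 2 ≤ n - 1) {t : R} (ht : ∑ j ∈ Finset.range (n - 1), t ^ j = 0) {k : ℕ}
    (hk : k ≠ 0) :
    (List.ofFn fun i : Fin (n - 2) => burauMatrix n R t (Fin.castLE hle i)).prod ^ k ≠ 1 := by
  set A := (List.ofFn fun i : Fin (n - 2) => burauMatrix n R t (Fin.castLE hle i)).prod with hA
  have key : ∀ f g : ℕ → R, f 0 = 0 → f (n - 1) = g (n - 1) →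
      (∀ k < n - 2, g (k + 1) = t * f k - t * f (k + 1) + g (k + 2)) →
      A *ᵥ shiftedVec n f = shiftedVec n g := by
    intro f g hf hlast hfg
    rw [hA, ← prod_burauMatrix_mulVec_s18 t hf (n - 2) hle le_rfl hfg]
    congr 1
    ext c
    simp only [shiftedVec]
    split_ifs with hc
    · rfl
    · rwa [show (c : ℕ) + 1 = n - 1 by omega]
  let u : ℕ → R := fun k => ∑ j ∈ Finset.range k, t ^ j
  let x : ℕ → R := fun k => ∑ j ∈ Finset.range k, (j : R) * t ^ j
  have hu : A *ᵥ shiftedVec n u = shiftedVec n u := by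
    refine key u u (by simp [u]) rfl fun k _ => ?_
    simp only [u, Finset.sum_range_succ]
    ring
  have hx : A *ᵥ shiftedVec n x = shiftedVec n x - shiftedVec n u := by
    refine key x (fun k => x k - u k) (by simp [x]) (by simp [u, ht]) fun k _ => ?_
    simp only [u, x, Finset.sum_range_succ]
    push_cast
    ring
  intro hone
  have hpow := congrFun (pow_mulVec_of_mulVec_eq_sub hu hx k) ⟨0, by omega⟩
  rw [hone] at hpow
  simp [shiftedVec, u, x, hk] at hpow

/-- For `(n,d) = (4,6), (5,4), (7,3)` and `q` a primitive `d`-th root of unity, the image of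
the full twist `τ_{n-1}` under the reduced Burau representation specialized at `t = -q`,
namely `M = (B₁(-q) ⋯ B_{n-2}(-q))^{n-1}`, has infinite order: `M^m ≠ I` for all `m ≥ 1`. -/
theorem burau_subTwist_infinite_order (n d : ℕ) (h : (n, d) ∈ [(4, 6), (5, 4), (7, 3)])
    (q : ℂ) (hq : IsPrimitiveRoot q d) :
    ∀ m : ℕ, 0 < m →
      (((List.ofFn fun i : Fin (n - 2) =>
        burauMatrix n ℂ (-q) (Fin.castLE (by omega) i)).prod) ^ (n - 1)) ^ m ≠ 1 := by
  intro m hm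
  have hn : 3 ≤ n := by
    simp only [List.mem_cons, Prod.mk.injEq, List.not_mem_nil, or_false] at h
    omega
  rw [← pow_mul]
  refine prod_burauMatrix_pow_ne_one hn _ ?_ (Nat.mul_ne_zero (by omega) hm.ne')
  have hpow : (-q) ^ (n - 1) = 1 ∧ -q ≠ 1 := by
    have hsq : ∀ e, 0 < e → e < d → q ^ e ≠ 1 :=
      fun e he hed => hq.pow_ne_one_of_pos_of_lt he.ne' hed
    have hd := hq.pow_eq_one
    simp only [List.mem_cons, Prod.mk.injEq, List.not_mem_nil, or_false] at h
    have hneg : -q = 1 → q ^ 2 = 1 := fun hq1 => by rw [← neg_sq, hq1, one_pow]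
    refine ⟨?_, fun hq1 => hsq 2 (by omega) (by omega) (hneg hq1)⟩
    rcases h with ⟨rfl, rfl⟩ | ⟨rfl, rfl⟩ | ⟨rfl, rfl⟩
    · have hfac : (q ^ 3 - 1) * (q ^ 3 + 1) = 0 := by linear_combination hd
      have h3 := (mul_eq_zero.1 hfac).resolve_left (sub_ne_zero.2 (hsq 3 (by omega) (by omega)))
      linear_combination -h3
    · linear_combination hd
    · linear_combination (q ^ 3 + 1) * hd
  have hgeom := mul_neg_geom_sum (-q) (n - 1)
  rw [hpow.1, sub_self] at hgeom
  exact (mul_eq_zero.1 hgeom).resolve_left (sub_ne_zero.2 hpow.2.symm)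
end
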